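/- arXiv:2403.07484 — 7 statements merged into one kernel-verified Lean document; each statement's English description precedes it below -/
import Mathlib

section
/- If a free filter F on ω does not have the Nikodym property, then F, regarded as a subset of the Cantor space P(ℕ) ≅ 2^ℕ, is meager and has measure zero with respect to the uniform (coin-flipping) product probability measure on 2^ℕ. In particular, every free ultrafilter on ω has the Nikodym property. -/
open Filter Topology Set MeasureTheory
open scoped ENNReal NNReal

noncomputable section

/-- The space `N_F = ℕ ∪ {p_F}`, modelled as `Option ℕ` with `none` playing the role of `p_F`:
every natural number (i.e. `some n`) is isolated, and a set containing `none` is open iff its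
trace on `ℕ` belongs to `F`. -/
def NFTop (F : Filter ℕ) : TopologicalSpace (Option ℕ) where
  IsOpen U := none ∈ U → {n : ℕ | some n ∈ U} ∈ F
  isOpen_univ := fun _ => Filter.univ_mem
  isOpen_inter := fun U V hU hV h => Filter.inter_mem (hU h.1) (hV h.2)
  isOpen_sUnion := fun S hS h => by
    obtain ⟨U, hUS, hU⟩ := h
    exact Filter.mem_of_superset (hS U hUS hU) fun n hn => ⟨U, hUS, hn⟩

/-- A finitely supported signed measure on `N_F` is modelled as a finitely supported
function `Option ℕ →₀ ℝ`; its value on a set `A` is the sum of its weights on `A`. -/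
def fsMeas (μ : Option ℕ →₀ ℝ) (A : Set (Option ℕ)) : ℝ :=
  ∑ x ∈ μ.support, A.indicator (fun y => μ y) x

/-- The norm `‖μ‖ = Σ |α_i|` of a finitely supported signed measure. -/
def fsNorm (μ : Option ℕ →₀ ℝ) : ℝ :=
  ∑ x ∈ μ.support, |μ x|

/-- `‖μ ↾ B‖`, the variation of `μ` on a set `B`. -/
def fsRestrNorm (μ : Option ℕ →₀ ℝ) (B : Set (Option ℕ)) : ℝ :=
  ∑ x ∈ μ.support, B.indicator (fun y => |μ y|) x

/-- The integral `∫ f dμ` of a function against a finitely supported signed measure. -/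
def fsInteg (μ : Option ℕ →₀ ℝ) (f : Option ℕ → ℝ) : ℝ :=
  ∑ x ∈ μ.support, μ x * f x

/-- An anti-Nikodym sequence on `N_F`: `‖μ_n‖ → ∞` and `μ_n(A) → 0` for every clopen `A`. -/
def IsANSeq (F : Filter ℕ) (μ : ℕ → (Option ℕ →₀ ℝ)) : Prop :=
  Tendsto (fun n => fsNorm (μ n)) atTop atTop ∧
    ∀ A : Set (Option ℕ), @IsClopen _ (NFTop F) A →
      Tendsto (fun n => fsMeas (μ n) A) atTop (nhds 0)

/-- A free filter `F` has the Nikodym property if there is no anti-Nikodym sequence on `N_F`. -/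
def HasNikodymProp (F : Filter ℕ) : Prop :=
  ¬ ∃ μ : ℕ → (Option ℕ →₀ ℝ), IsANSeq F μ

/-- A finitely supported (nonnegative) measure on `ℕ`, evaluated on a set `A ⊆ ℕ`. -/
def natMeas (μ : ℕ →₀ ℝ) (A : Set ℕ) : ℝ :=
  ∑ x ∈ μ.support, A.indicator (fun y => μ y) x

/-- The norm of a finitely supported measure on `ℕ`. -/
def natNorm (μ : ℕ →₀ ℝ) : ℝ :=
  ∑ x ∈ μ.support, |μ x|

/-- `at⁺(μ)`: the largest atom of a finitely supported measure on `ℕ`. -/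
def atPlus (μ : ℕ →₀ ℝ) : ℝ := sSup ((fun x => μ x) '' ↑μ.support)

/-- `at⁻(μ)`: the smallest atom of a finitely supported measure on `ℕ`. -/
def atMinus (μ : ℕ →₀ ℝ) : ℝ := sInf ((fun x => μ x) '' ↑μ.support)

/-- A submeasure on `ω`. -/
structure Submeasure where
  toFun : Set ℕ → ℝ≥0∞
  empty' : toFun ∅ = 0
  finite_singleton' : ∀ n : ℕ, toFun {n} ≠ ⊤
  mono' : ∀ ⦃A B : Set ℕ⦄, A ⊆ B → toFun A ≤ toFun B
  subadd' : ∀ A B : Set ℕ, toFun (A ∪ B) ≤ toFun A + toFun B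

/-- Lower semicontinuity of a submeasure: `φ(A) = lim_n φ(A ∩ [0,n])`. -/
def Submeasure.LSC (φ : Submeasure) : Prop :=
  ∀ A : Set ℕ, Tendsto (fun n : ℕ => φ.toFun (A ∩ Set.Iic n)) atTop (nhds (φ.toFun A))

/-- The exhaustive ideal `Exh(φ) = {A : lim_n φ(A ∖ [0,n]) = 0}` of a submeasure. -/
def Exh (φ : Submeasure) : Set (Set ℕ) :=
  {A : Set ℕ | Tendsto (fun n : ℕ => φ.toFun (A \ Set.Iic n)) atTop (nhds 0)}

/-- A density submeasure: `φ = sup_n μ_n` for a sequence of finitely supported nonnegative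
measures on `ℕ` with pairwise disjoint supports. -/
def Submeasure.IsDensity (φ : Submeasure) : Prop :=
  ∃ μ : ℕ → (ℕ →₀ ℝ), (∀ n x, 0 ≤ μ n x) ∧
    (∀ m n, m ≠ n → Disjoint (μ m).support (μ n).support) ∧
    ∀ A : Set ℕ, φ.toFun A = ⨆ n : ℕ, ENNReal.ofReal (natMeas (μ n) A)

/-- A non-pathological submeasure: `φ(A)` is the supremum of `μ(A)` over all nonnegative
(σ-additive) measures `μ` on `ℕ` dominated by `φ`. -/
def Submeasure.Nonpathological (φ : Submeasure) : Prop :=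
  ∀ A : Set ℕ,
    φ.toFun A =
      ⨆ (w : ℕ → ℝ≥0∞) (_ : ∀ B : Set ℕ, ∑' n : B, w n ≤ φ.toFun B), ∑' n : A, w n

/-- An ideal on `ω`: contains all finite sets, closed under subsets and finite unions,
and does not contain `ℕ` itself. -/
def IsIdeal (I : Set (Set ℕ)) : Prop :=
  (∀ A : Set ℕ, A.Finite → A ∈ I) ∧
    (∀ A B : Set ℕ, A ⊆ B → B ∈ I → A ∈ I) ∧
    (∀ A B : Set ℕ, A ∈ I → B ∈ I → A ∪ B ∈ I) ∧
    Set.univ ∉ I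

/-- The Katětov order on families of subsets of `ℕ`. -/
def KatLE (I J : Set (Set ℕ)) : Prop :=
  ∃ f : ℕ → ℕ, ∀ A ∈ I, f ⁻¹' A ∈ J

/-- The dual filter `I*` of an ideal `I` (as a `Filter`; when `I` is an ideal, this filter's
sets are exactly the complements of members of `I`). -/
def dualFilter (I : Set (Set ℕ)) : Filter ℕ :=
  Filter.generate {A : Set ℕ | Aᶜ ∈ I}

/-- The class `AN` of all ideals on `ω` whose dual filters do not have the Nikodym property. -/
def ANclass : Set (Set (Set ℕ)) :=
  {I | IsIdeal I ∧ ¬ HasNikodymProp (dualFilter I)}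

/-- A density ideal: `Exh(sup_n μ_n)` for a disjointly supported sequence of finitely
supported nonnegative measures on `ℕ`. -/
def IsDensityIdeal (I : Set (Set ℕ)) : Prop :=
  ∃ μ : ℕ → (ℕ →₀ ℝ), (∀ n x, 0 ≤ μ n x) ∧
    (∀ m n, m ≠ n → Disjoint (μ m).support (μ n).support) ∧
    I = {A : Set ℕ |
      Tendsto (fun m : ℕ => ⨆ n : ℕ, ENNReal.ofReal (natMeas (μ n) (A \ Set.Iic m)))
        atTop (nhds 0)}

/-- The asymptotic density submeasure `φ_d(A) = sup_n |A ∩ [2^n, 2^{n+1})|/2^n`. -/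
def phid (A : Set ℕ) : ℝ≥0∞ :=
  ⨆ n : ℕ, ((A ∩ Set.Ico (2 ^ n) (2 ^ (n + 1))).ncard : ℝ≥0∞) / 2 ^ n

/-- The asymptotic density zero ideal `Z = Exh(φ_d)`. -/
def Zideal : Set (Set ℕ) :=
  {A : Set ℕ | Tendsto (fun m : ℕ => phid (A \ Set.Iic m)) atTop (nhds 0)}

/-- `Exh(sup_{n ≥ 1} ν_n)` for a sequence of finitely supported measures indexed by `n ≥ 1`. -/
def ExhSupPos (ν : ℕ → (ℕ →₀ ℝ)) : Set (Set ℕ) :=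
  {A : Set ℕ |
    Tendsto (fun m : ℕ => ⨆ n : ℕ, ENNReal.ofReal (natMeas (ν (n + 1)) (A \ Set.Iic m)))
      atTop (nhds 0)}

/-- `PhiStart f n` is the left endpoint of the interval `I_n` in the interval partition
associated with `f` (so `I_n = [PhiStart f n, PhiStart f (n+1))` has `n·f(n)` elements). -/
def PhiStart (f : ℕ → ℕ) (n : ℕ) : ℕ :=
  ∑ k ∈ Finset.range n, k * f k

/-- The density ideal `Φ(f) = Exh(sup_{n≥1} μ_n^f)`, where `μ_n^f` gives mass `1/f(n)` to each
point of the interval `I_n` (of size `n·f(n)`), so that `‖μ_n^f‖ = n`. -/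
def PhiIdeal (f : ℕ → ℕ) : Set (Set ℕ) :=
  {A : Set ℕ |
    Tendsto (fun m : ℕ => ⨆ n : ℕ,
        ENNReal.ofReal
          (((A \ Set.Iic m) ∩ Set.Ico (PhiStart f (n + 1)) (PhiStart f (n + 2))).ncard
            / f (n + 1)))
      atTop (nhds 0)}

/-- The dominating number `𝔡`. -/
def domNumber : Cardinal :=
  sInf {c : Cardinal | ∃ D : Set (ℕ → ℕ), Cardinal.mk D = c ∧
    ∀ g : ℕ → ℕ, ∃ f ∈ D, ∀ᶠ n in atTop, g n ≤ f n}

/-- The unbounding number `𝔟`. -/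
def unbNumber : Cardinal :=
  sInf {c : Cardinal | ∃ U : Set (ℕ → ℕ), Cardinal.mk U = c ∧
    ∀ g : ℕ → ℕ, ∃ f ∈ U, {n : ℕ | g n < f n}.Infinite}

/-- A P-ideal: every countable family in `J` has a pseudo-union in `J`. -/
def IsPIdeal (J : Set (Set ℕ)) : Prop :=
  ∀ A : ℕ → Set ℕ, (∀ n, A n ∈ J) → ∃ B ∈ J, ∀ n, (A n \ B).Finite

/-- The characteristic-function embedding of `P(ℕ)` into the Cantor space `2^ℕ`. -/
def chi (A : Set ℕ) : ℕ → Bool :=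
  fun n => @decide (n ∈ A) (Classical.propDecidable _)

end
/-- The mass that the weights `w n` on the finite set `T n` put on the zeros of `x`. -/
def zeroMass (T : ℕ → Finset ℕ) (w : ℕ → ℕ → ℝ) (n : ℕ) (x : ℕ → Bool) : ℝ :=
  ∑ i ∈ T n, if x i = false then w n i else 0

/-- The points of the Cantor space whose zeros have eventually bounded mass. -/
def boundedZeroMass (T : ℕ → Finset ℕ) (w : ℕ → ℕ → ℝ) : Set (ℕ → Bool) :=
  {x | ∃ K : ℕ, ∀ n ≥ K, zeroMass T w n x ≤ K}

theorem isClopen_of_none_notMem {F : Filter ℕ} {B : Set (Option ℕ)} (hB : none ∉ B)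
    (h : {n : ℕ | some n ∉ B} ∈ F) : @IsClopen _ (NFTop F) B :=
  ⟨@IsClosed.mk _ (NFTop F) _ fun _ => h, fun hn => absurd hn hB⟩

theorem sum_support_eq_option (μ : Option ℕ →₀ ℝ) (f : Option ℕ → ℝ)
    (hf : ∀ x, μ x = 0 → f x = 0) :
    ∑ x ∈ μ.support, f x = f none + ∑ i ∈ μ.support.eraseNone, f (some i) := by
  rw [← Finset.sum_insertNone]
  refine Finset.sum_subset (fun x hx => ?_) fun x _ hx => hf x (by simpa using hx)
  cases x <;> simp_all

theorem fsMeas_eq_sum_some (μ : Option ℕ →₀ ℝ) {B : Set (Option ℕ)} (hB : none ∉ B) :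
    fsMeas μ B = ∑ i ∈ μ.support.eraseNone, B.indicator (fun y => μ y) (some i) := by
  rw [fsMeas, sum_support_eq_option, Set.indicator_of_notMem hB, zero_add]
  intro x hx
  by_cases h : x ∈ B <;> simp [h, hx]

theorem IsANSeq.tendsto_some {F : Filter ℕ} {μ : ℕ → (Option ℕ →₀ ℝ)} (hμ : IsANSeq F μ)
    (hF : F ≤ cofinite) (k : ℕ) : Tendsto (fun n => μ n (some k)) atTop (𝓝 0) := by
  have hcl : @IsClopen _ (NFTop F) {some k} := by
    refine isClopen_of_none_notMem (by simp) (hF ?_)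
    simp [Filter.mem_cofinite]
  refine (hμ.2 _ hcl).congr fun n => ?_
  classical
  simp only [fsMeas, Set.indicator_apply, Set.mem_singleton_iff]
  rw [Finset.sum_ite_eq']
  split_ifs with h
  · rfl
  · simpa using (Finsupp.notMem_support_iff.1 h).symm

theorem IsANSeq.tendsto_sum_abs_some {F : Filter ℕ} {μ : ℕ → (Option ℕ →₀ ℝ)}
    (hμ : IsANSeq F μ) :
    Tendsto (fun n => ∑ i ∈ (μ n).support.eraseNone, |μ n (some i)|) atTop atTop := by
  have huniv := hμ.2 Set.univ (@isClopen_univ _ (NFTop F))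
  have h1 : ∀ᶠ n in atTop, |fsMeas (μ n) Set.univ| < 1 := by
    simpa using huniv.abs.eventually_lt_const (by simp : |(0 : ℝ)| < 1)
  have h2 : Tendsto (fun n => (fsNorm (μ n) - 1) / 2) atTop atTop :=
    (tendsto_atTop_add_const_right _ (-1) hμ.1).atTop_div_const two_pos
  refine tendsto_atTop_mono' _ ?_ h2
  filter_upwards [h1] with n hn
  have e1 : fsNorm (μ n) = |μ n none| + ∑ i ∈ (μ n).support.eraseNone, |μ n (some i)| :=
    sum_support_eq_option (μ n) (fun x => |μ n x|) fun x hx => by simp [hx]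
  have e2 : fsMeas (μ n) Set.univ = μ n none + ∑ i ∈ (μ n).support.eraseNone, μ n (some i) := by
    simp only [fsMeas, Set.indicator_univ]
    exact sum_support_eq_option (μ n) (fun x => μ n x) fun x hx => hx
  have h3 := Finset.abs_sum_le_sum_abs (fun i => μ n (some i)) (μ n).support.eraseNone
  have h4 : |μ n none| ≤ |fsMeas (μ n) Set.univ|
      + |∑ i ∈ (μ n).support.eraseNone, μ n (some i)| := by
    have := abs_sub (fsMeas (μ n) Set.univ) (∑ i ∈ (μ n).support.eraseNone, μ n (some i))
    rwa [e2, add_sub_cancel_right, ← e2] at this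
  linarith

/-- A pointwise-null sequence of finite signed measures, evaluated on subsets of `D`, is uniformly
bounded on a neighbourhood by the Baire category theorem; hence its variation on `D` is bounded. -/
theorem eventually_sum_abs_le_of_tendsto_subsets (T : ℕ → Finset ℕ) (v : ℕ → ℕ → ℝ) (D : Set ℕ)
    [DecidablePred (· ∈ D)] (hv : ∀ k, Tendsto (fun n => v n k) atTop (𝓝 0))
    (hD : ∀ x : ℕ → Bool,
      Tendsto (fun n => ∑ i ∈ T n, if i ∈ D ∧ x i = true then v n i else 0) atTop (𝓝 0)) :
    ∀ᶠ n in atTop, ∑ i ∈ T n, (if i ∈ D then |v n i| else 0) ≤ 3 := by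
  set S : ℕ → (ℕ → Bool) → ℝ :=
    fun n x => ∑ i ∈ T n, if i ∈ D ∧ x i = true then v n i else 0 with hS
  have hcont : ∀ n, Continuous (S n) := fun n => by
    refine continuous_finsetSum _ fun i _ => ?_
    exact (continuous_of_discreteTopology
      (f := fun b : Bool => if i ∈ D ∧ b = true then v n i else 0)).comp (continuous_apply i)
  set C : ℕ → Set (ℕ → Bool) := fun N => {x | ∀ n ≥ N, |S n x| ≤ 1} with hC
  have hclosed : ∀ N, IsClosed (C N) := fun N => by
    simp only [hC, Set.ofPred_forall]
    exact isClosed_iInter fun n => isClosed_iInter fun _ =>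
      isClosed_le (hcont n).abs continuous_const
  have hcover : ⋃ N, C N = Set.univ := by
    refine Set.eq_univ_of_forall fun x => Set.mem_iUnion.2 ?_
    have h1 : ∀ᶠ n in atTop, |S n x| < 1 := by
      simpa using (hD x).abs.eventually_lt_const (by simp : |(0 : ℝ)| < 1)
    obtain ⟨N, hN⟩ := eventually_atTop.1 h1
    exact ⟨N, fun n hn => (hN n hn).le⟩
  obtain ⟨N, x₀, hx₀⟩ := nonempty_interior_of_iUnion_of_closed hclosed hcover
  obtain ⟨I, u, hu, hI⟩ := isOpen_pi_iff.1 isOpen_interior x₀ hx₀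
  have hmem : ∀ y : ℕ → Bool, (∀ i ∈ I, y i = x₀ i) → y ∈ C N := fun y hy =>
    interior_subset (hI fun i hi => by rw [hy i hi]; exact (hu i hi).2)
  have hsmall : ∀ᶠ n in atTop, ∑ i ∈ I, |v n i| < 1 := by
    have : Tendsto (fun n => ∑ i ∈ I, |v n i|) atTop (𝓝 (∑ i ∈ I, |(0 : ℝ)|)) :=
      tendsto_finsetSum _ fun i _ => (hv i).abs
    exact this.eventually_lt_const (by simp)
  filter_upwards [hsmall, eventually_ge_atTop N] with n hn hnN
  set y₁ : ℕ → Bool := fun i => if i ∈ I then x₀ i else decide (0 ≤ v n i) with hy₁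
  set y₂ : ℕ → Bool := fun i => if i ∈ I then x₀ i else decide (v n i < 0) with hy₂
  have b₁ := abs_le.1 (hmem y₁ (fun i hi => by simp [hy₁, hi]) n hnN)
  have b₂ := abs_le.1 (hmem y₂ (fun i hi => by simp [hy₂, hi]) n hnN)
  have hle : ∑ i ∈ T n, (if i ∈ D then |v n i| else 0) ≤
      S n y₁ - S n y₂ + ∑ i ∈ T n, if i ∈ I then |v n i| else 0 := by
    simp only [hS]
    rw [← Finset.sum_sub_distrib, ← Finset.sum_add_distrib]
    refine Finset.sum_le_sum fun i _ => ?_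
    have := abs_nonneg (v n i)
    by_cases hiI : i ∈ I
    · by_cases hiD : i ∈ D <;> simp [hy₁, hy₂, hiI, hiD]
    · by_cases hiD : i ∈ D
      · rcases le_or_gt 0 (v n i) with h | h
        · simp [hy₁, hy₂, hiI, hiD, h, not_lt.2 h, abs_of_nonneg h]
        · simp [hy₁, hy₂, hiI, hiD, h, not_le.2 h, abs_of_neg h]
      · simp [hiI, hiD]
  have hTI : ∑ i ∈ T n, (if i ∈ I then |v n i| else 0) ≤ ∑ i ∈ I, |v n i| := by
    rw [← Finset.sum_filter]
    exact Finset.sum_le_sum_of_subset_of_nonneg (fun i hi => (Finset.mem_filter.1 hi).2)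
      fun _ _ _ => abs_nonneg _
  linarith [b₁.2, b₂.1]

theorem exists_weights_of_not_hasNikodymProp {F : Filter ℕ} (hF : F ≤ cofinite)
    (h : ¬ HasNikodymProp F) :
    ∃ (T : ℕ → Finset ℕ) (w : ℕ → ℕ → ℝ), (∀ n i, 0 ≤ w n i) ∧
      (∀ k, Tendsto (fun n => w n k) atTop (𝓝 0)) ∧
      Tendsto (fun n => ∑ i ∈ T n, w n i) atTop atTop ∧
      chi '' F.sets ⊆ boundedZeroMass T w := by
  classical
  obtain ⟨μ, hμ⟩ := not_not.1 h
  refine ⟨fun n => (μ n).support.eraseNone, fun n i => |μ n (some i)|, fun n i => abs_nonneg _,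
    fun k => by simpa using (hμ.tendsto_some hF k).abs, hμ.tendsto_sum_abs_some, ?_⟩
  rintro _ ⟨A, hA, rfl⟩
  have key := eventually_sum_abs_le_of_tendsto_subsets (fun n => (μ n).support.eraseNone)
    (fun n i => μ n (some i)) Aᶜ (hμ.tendsto_some hF) fun x => by
      let B : Set (Option ℕ) := some '' {i | i ∈ Aᶜ ∧ x i = true}
      have hB : none ∉ B := by simp [B]
      refine (hμ.2 B (isClopen_of_none_notMem hB ?_)).congr fun n => ?_
      · exact F.mem_of_superset hA fun i hi => by simp [B, hi]
      · rw [fsMeas_eq_sum_some _ hB]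
        exact Finset.sum_congr rfl fun i _ => by simp [B, Set.indicator_apply]
  obtain ⟨K, hK⟩ := eventually_atTop.1 key
  refine ⟨max K 3, fun n hn => ?_⟩
  have h3 : (3 : ℝ) ≤ ((max K 3 : ℕ) : ℝ) := by exact_mod_cast le_max_right K 3
  refine le_trans (le_of_eq ?_) ((hK n (le_trans (le_max_left _ _) hn)).trans h3)
  exact Finset.sum_congr rfl fun i _ => by simp [chi]

section Weights

variable {T : ℕ → Finset ℕ} {w : ℕ → ℕ → ℝ}

theorem continuous_zeroMass (n : ℕ) : Continuous (zeroMass T w n) :=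
  continuous_finsetSum _ fun i _ =>
    (continuous_of_discreteTopology
      (f := fun b : Bool => if b = false then w n i else 0)).comp (continuous_apply i)

theorem eventually_sum_finset_lt_one (hw : ∀ k, Tendsto (fun n => w n k) atTop (𝓝 0))
    (I : Finset ℕ) : ∀ᶠ n in atTop, ∑ i ∈ I, w n i < 1 := by
  have : Tendsto (fun n => ∑ i ∈ I, w n i) atTop (𝓝 (∑ i ∈ I, (0 : ℝ))) :=
    tendsto_finsetSum _ fun i _ => hw i
  exact this.eventually_lt_const (by simp)

theorem sum_inter_le (h0 : ∀ n i, 0 ≤ w n i) (I : Finset ℕ) (n : ℕ) :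
    ∑ i ∈ T n, (if i ∈ I then w n i else 0) ≤ ∑ i ∈ I, w n i := by
  rw [← Finset.sum_filter]
  exact Finset.sum_le_sum_of_subset_of_nonneg (fun i hi => (Finset.mem_filter.1 hi).2)
    fun _ _ _ => h0 _ _

theorem isMeagre_boundedZeroMass (h0 : ∀ n i, 0 ≤ w n i)
    (hw : ∀ k, Tendsto (fun n => w n k) atTop (𝓝 0))
    (hT : Tendsto (fun n => ∑ i ∈ T n, w n i) atTop atTop) :
    IsMeagre (boundedZeroMass T w) := by
  rw [boundedZeroMass, Set.ofPred_exists]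
  refine isMeagre_iUnion fun K => IsNowhereDense.isMeagre ?_
  have hcl : IsClosed {x : ℕ → Bool | ∀ n ≥ K, zeroMass T w n x ≤ K} := by
    simp only [Set.ofPred_forall]
    exact isClosed_iInter fun n => isClosed_iInter fun _ =>
      isClosed_le (continuous_zeroMass n) continuous_const
  rw [hcl.isNowhereDense_iff, Set.eq_empty_iff_forall_notMem]
  intro x hx
  obtain ⟨I, u, hu, hI⟩ := isOpen_pi_iff.1 isOpen_interior x hx
  set y : ℕ → Bool := fun i => if i ∈ I then x i else false with hy
  have hyK : ∀ n ≥ K, zeroMass T w n y ≤ K := interior_subset (hI fun i hi => by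
    have : y i = x i := by simp [hy, Finset.mem_coe.1 hi]
    rw [this]; exact (hu i hi).2)
  obtain ⟨n, hn, hn1, hnK⟩ := ((hT.eventually_gt_atTop (K + 1 : ℝ)).and
    ((eventually_sum_finset_lt_one hw I).and (eventually_ge_atTop K))).exists
  have hle : ∑ i ∈ T n, w n i ≤
      zeroMass T w n y + ∑ i ∈ T n, if i ∈ I then w n i else 0 := by
    rw [zeroMass, ← Finset.sum_add_distrib]
    refine Finset.sum_le_sum fun i _ => ?_
    have := h0 n i
    by_cases hi : i ∈ I
    · simp only [hi, if_true]; split_ifs <;> linarith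
    · simp [hy, hi]
  linarith [hyK n hnK, sum_inter_le (T := T) h0 I n]

theorem notMem_boundedZeroMass_not (hT : Tendsto (fun n => ∑ i ∈ T n, w n i) atTop atTop)
    {x : ℕ → Bool} (hx : x ∈ boundedZeroMass T w) :
    (fun i => !x i) ∉ boundedZeroMass T w := by
  rintro ⟨L, hL⟩
  obtain ⟨K, hK⟩ := hx
  obtain ⟨n, hn, hnK, hnL⟩ := ((hT.eventually_gt_atTop (K + L : ℝ)).and
    ((eventually_ge_atTop K).and (eventually_ge_atTop L))).exists
  have : ∑ i ∈ T n, w n i = zeroMass T w n x + zeroMass T w n (fun i => !x i) := by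
    rw [zeroMass, zeroMass, ← Finset.sum_add_distrib]
    exact Finset.sum_congr rfl fun i _ => by cases x i <;> simp
  linarith [hK n hnK, hL n hnL]

theorem measurableSet_eventually_le {Ω : Type*} [MeasurableSpace Ω] {g : ℕ → Ω → ℝ}
    (hg : ∀ n, Measurable (g n)) : MeasurableSet {x | ∃ K : ℕ, ∀ n ≥ K, g n x ≤ K} := by
  simp only [Set.ofPred_exists, Set.ofPred_forall]
  exact MeasurableSet.iUnion fun K => MeasurableSet.iInter fun n => MeasurableSet.iInter fun _ =>
    measurableSet_le (hg n) measurable_const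

theorem measurableSet_boundedZeroMass : MeasurableSet (boundedZeroMass T w) :=
  measurableSet_eventually_le fun n => (continuous_zeroMass n).measurable

theorem boundedZeroMass_eq_tail (h0 : ∀ n i, 0 ≤ w n i)
    (hw : ∀ k, Tendsto (fun n => w n k) atTop (𝓝 0)) (k : ℕ) :
    boundedZeroMass T w = {x | ∃ K : ℕ, ∀ n ≥ K,
      (∑ i ∈ T n, if k ≤ i ∧ x i = false then w n i else 0) ≤ K} := by
  ext x
  constructor
  · rintro ⟨K, hK⟩
    refine ⟨K, fun n hn => le_trans (Finset.sum_le_sum fun i _ => ?_) (hK n hn)⟩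
    have := h0 n i
    split_ifs <;> simp_all
  · rintro ⟨K, hK⟩
    obtain ⟨N, hN⟩ := eventually_atTop.1 (eventually_sum_finset_lt_one hw (Finset.range k))
    refine ⟨max (K + 1) N, fun n hn => ?_⟩
    have h1 := hK n (by have := le_max_left (K + 1) N; omega)
    have h2 := hN n (le_trans (le_max_right _ _) hn)
    have h3 : ((K + 1 : ℕ) : ℝ) ≤ ((max (K + 1) N : ℕ) : ℝ) := by
      exact_mod_cast le_max_left (K + 1) N
    have hle : zeroMass T w n x ≤ (∑ i ∈ T n, if k ≤ i ∧ x i = false then w n i else 0) +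
        ∑ i ∈ T n, if i ∈ Finset.range k then w n i else 0 := by
      rw [zeroMass, ← Finset.sum_add_distrib]
      refine Finset.sum_le_sum fun i _ => ?_
      have := h0 n i
      by_cases hi : k ≤ i
      · simp [hi, not_lt.2 hi]
      · simp only [hi, Finset.mem_range, not_le.1 hi, false_and, if_true, if_false]
        split_ifs <;> linarith
    have h4 := sum_inter_le (T := T) h0 (Finset.range k) n
    rw [Nat.cast_add_one] at h3
    linarith

end Weights

section CoinFlip

theorem measurableSet_coord_true (i : ℕ) : MeasurableSet {x : ℕ → Bool | x i = true} :=
  measurableSet_eq_fun (measurable_pi_apply i) measurable_const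

/-- The uniform coin-flipping condition on a measure on the Cantor space. -/
def IsCoinFlip (P : Measure (ℕ → Bool)) : Prop :=
  ∀ (s : Finset ℕ) (b : ℕ → Bool),
    P {x : ℕ → Bool | ∀ i ∈ s, x i = b i} = (1 / 2 : ℝ≥0∞) ^ s.card

theorem measurable_pointwise_not :
    Measurable (fun (x : ℕ → Bool) (i : ℕ) => !x i) :=
  measurable_pi_lambda _ fun i => (measurable_of_countable fun b : Bool => !b).comp (measurable_pi_apply i)

theorem IsCoinFlip.map_not {P : Measure (ℕ → Bool)} [IsProbabilityMeasure P]
    (hP : IsCoinFlip P) : P.map (fun x i => !x i) = P := by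
  have hmeas : ∀ s : Finset ℕ, MeasurableSet {x : ℕ → Bool | ∀ i ∈ s, x i = true} := fun s => by
    simp only [Set.ofPred_forall]
    exact MeasurableSet.iInter fun i => MeasurableSet.iInter fun _ =>
      measurableSet_coord_true i
  have : IsProbabilityMeasure (P.map (fun x i => !x i)) :=
    Measure.isProbabilityMeasure_map measurable_pointwise_not.aemeasurable
  refine ext_of_generate_finite
    (Set.range fun s : Finset ℕ => {x : ℕ → Bool | ∀ i ∈ s, x i = true}) ?_ ?_ ?_ (by simp)
  · refine le_antisymm (iSup_le fun i => ?_) (MeasurableSpace.generateFrom_le ?_)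
    · rw [← measurable_iff_comap_le]
      refine @measurable_to_bool _ (MeasurableSpace.generateFrom _) _ ?_
      exact MeasurableSpace.measurableSet_generateFrom ⟨{i}, by ext x; simp⟩
    · rintro _ ⟨s, rfl⟩
      exact hmeas s
  · rintro _ ⟨s, rfl⟩ _ ⟨t, rfl⟩ _
    refine ⟨s ∪ t, ?_⟩
    ext x
    simp only [Finset.mem_union, Set.mem_ofPred_eq, Set.mem_inter_iff]
    exact ⟨fun h => ⟨fun i hi => h i (.inl hi), fun i hi => h i (.inr hi)⟩,
      fun h i hi => hi.elim (h.1 i) (h.2 i)⟩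
  · rintro _ ⟨s, rfl⟩
    rw [Measure.map_apply measurable_pointwise_not (hmeas s), hP s fun _ => true,
      ← hP s fun _ => false]
    congr 1
    ext x
    simp

theorem IsCoinFlip.iIndepSet {P : Measure (ℕ → Bool)} [IsProbabilityMeasure P]
    (hP : IsCoinFlip P) :
    ProbabilityTheory.iIndepSet (fun i : ℕ => {x : ℕ → Bool | x i = true}) P := by
  refine (ProbabilityTheory.iIndepSet_iff_meas_biInter fun i =>
    measurableSet_coord_true i).2 fun s => ?_
  have h1 : ∀ i, P {x : ℕ → Bool | x i = true} = 1 / 2 := fun i => by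
    simpa using hP {i} fun _ => true
  have h2 : (⋂ i ∈ s, {x : ℕ → Bool | x i = true}) = {x | ∀ i ∈ s, x i = true} := by
    ext x; simp
  rw [h2, hP s fun _ => true]
  simp [h1]

theorem IsCoinFlip.boundedZeroMass_null {P : Measure (ℕ → Bool)} [IsProbabilityMeasure P]
    (hP : IsCoinFlip P) {T : ℕ → Finset ℕ} {w : ℕ → ℕ → ℝ} (h0 : ∀ n i, 0 ≤ w n i)
    (hw : ∀ k, Tendsto (fun n => w n k) atTop (𝓝 0))
    (hT : Tendsto (fun n => ∑ i ∈ T n, w n i) atTop atTop) :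
    P (boundedZeroMass T w) = 0 := by
  have htail : MeasurableSet[limsup
      (fun i : ℕ => MeasurableSpace.generateFrom {{x : ℕ → Bool | x i = true}}) atTop]
      (boundedZeroMass T w) := by
    rw [limsup_eq_iInf_iSup_of_nat, MeasurableSpace.measurableSet_iInf]
    intro k
    rw [boundedZeroMass_eq_tail h0 hw k]
    refine @measurableSet_eventually_le _ (_) _ fun n => ?_
    refine Finset.measurable_sum _ fun i _ => ?_
    by_cases hi : k ≤ i
    · have hset : MeasurableSet[⨆ i ≥ k,
          MeasurableSpace.generateFrom {{x : ℕ → Bool | x i = true}}]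
          {x : ℕ → Bool | x i = true} :=
        le_iSup₂ (f := fun i (_ : i ≥ k) =>
            MeasurableSpace.generateFrom {{x : ℕ → Bool | x i = true}}) i hi _
          (MeasurableSpace.measurableSet_generateFrom rfl)
      refine Measurable.ite ?_ measurable_const measurable_const
      convert hset.compl using 1
      ext x
      simp [hi]
    · simp only [hi, false_and, if_false]
      exact measurable_const
  rcases ProbabilityTheory.measure_zero_or_one_of_measurableSet_limsup_atTop
    (fun i => MeasurableSpace.generateFrom_le fun t ht => by
      rw [Set.mem_singleton_iff.1 ht]
      exact measurableSet_coord_true i) hP.iIndepSet htail with h | h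
  · exact h
  · exfalso
    have hm : MeasurableSet (boundedZeroMass T w) := measurableSet_boundedZeroMass
    have h' : P ((fun (x : ℕ → Bool) i => !x i) ⁻¹' boundedZeroMass T w) = 1 := by
      rw [← Measure.map_apply measurable_pointwise_not hm, hP.map_not, h]
    have hsub : (fun (x : ℕ → Bool) i => !x i) ⁻¹' boundedZeroMass T w ⊆
        (boundedZeroMass T w)ᶜ := fun x hx hx' => notMem_boundedZeroMass_not hT hx' hx
    have hc := measure_mono (μ := P) hsub
    rw [h', prob_compl_eq_zero_iff hm |>.2 h] at hc
    exact absurd hc (by simp)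

end CoinFlip

theorem isMeagre_of_not_hasNikodymProp {F : Filter ℕ} (hF : F ≤ cofinite)
    (h : ¬ HasNikodymProp F) : IsMeagre (chi '' F.sets) := by
  obtain ⟨T, w, h0, hw, hT, hsub⟩ := exists_weights_of_not_hasNikodymProp hF h
  exact (isMeagre_boundedZeroMass h0 hw hT).mono hsub

theorem hasNikodymProp_ultrafilter (U : Ultrafilter ℕ) (hU : (U : Filter ℕ) ≤ cofinite) :
    HasNikodymProp (U : Filter ℕ) := by
  by_contra h
  have hM := isMeagre_of_not_hasNikodymProp hU h
  let e : (ℕ → Bool) ≃ₜ (ℕ → Bool) :=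
    Homeomorph.piCongrRight fun _ => (Equiv.boolNot).toHomeomorphOfDiscrete
  have hM' : IsMeagre (e ⁻¹' (chi '' (U : Filter ℕ).sets)) :=
    hM.preimage_of_isOpenMap e.continuous e.isOpenMap
  have hcover : chi '' (U : Filter ℕ).sets ∪ e ⁻¹' (chi '' (U : Filter ℕ).sets) = Set.univ := by
    refine Set.eq_univ_of_forall fun x => ?_
    rcases U.mem_or_compl_mem {i | x i = true} with hx | hx
    · exact .inl ⟨_, hx, by ext i; simp [chi]⟩
    · exact .inr ⟨_, hx, by ext i; simp [chi, e, Equiv.toHomeomorphOfDiscrete]⟩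
  have := hM.union hM'
  rw [hcover] at this
  exact not_isMeagre_of_isOpen isOpen_univ Set.univ_nonempty this

/-- Corollary `ultrafilter`. If a free filter `F` on `ω` does not have the
Nikodym property then, viewed as a subset of the Cantor space `2^ℕ` via characteristic
functions, `F` is meager and null for the uniform coin-flipping product probability measure
(formally: every probability measure giving each cylinder `{x : ∀ i ∈ s, x i = b i}` the value
`(1/2)^|s|` vanishes on `F`). In particular, every free ultrafilter on `ω` has the Nikodym
property. -/
theorem not_nikodym_meager_null_and_ultrafilter :
    (∀ F : Filter ℕ, F ≤ Filter.cofinite → F.NeBot → ¬ HasNikodymProp F →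
      IsMeagre (chi '' F.sets) ∧
        ∀ P : Measure (ℕ → Bool), IsProbabilityMeasure P →
          (∀ (s : Finset ℕ) (b : ℕ → Bool),
            P {x : ℕ → Bool | ∀ i ∈ s, x i = b i} = (1 / 2 : ℝ≥0∞) ^ s.card) →
          P (chi '' F.sets) = 0) ∧
    ∀ U : Ultrafilter ℕ, (U : Filter ℕ) ≤ Filter.cofinite →
      HasNikodymProp (U : Filter ℕ) := by
  refine ⟨fun F hF _ hN => ⟨isMeagre_of_not_hasNikodymProp hF hN, fun P _ hP => ?_⟩,
    hasNikodymProp_ultrafilter⟩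
  obtain ⟨T, w, h0, hw, hT, hsub⟩ := exists_weights_of_not_hasNikodymProp hF hN
  exact measure_mono_null hsub (IsCoinFlip.boundedZeroMass_null hP h0 hw hT)
end

section
/- Let φ be a lower semicontinuous submeasure on ω and I = Exh(φ). If I is totally bounded, i.e., every lower semicontinuous submeasure ψ on ω with Exh(ψ) = I satisfies ψ(ℕ) < ∞, then the dual filter I* has the Nikodym property. -/
open Filter Topology Set MeasureTheory
open scoped ENNReal NNReal

/-- Schur's theorem for finitely supported signed measures: setwise convergence to zero implies
convergence to zero in variation. -/
theorem tendsto_sum_abs_of_tendsto_sum_indicator {ι : Type*} (s : ℕ → Finset ι) (w : ℕ → ι → ℝ)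
    (h : ∀ B : Set ι, Tendsto (fun n => ∑ x ∈ s n, B.indicator (w n) x) atTop (𝓝 0)) :
    Tendsto (fun n => ∑ x ∈ s n, |w n x|) atTop (𝓝 0) := by
  classical
  rw [Metric.tendsto_atTop]
  intro ε hε
  set S : ℕ → (ι → Bool) → ℝ := fun n b => ∑ x ∈ s n, if b x then w n x else 0 with hS
  have hclosed : ∀ N, IsClosed {b : ι → Bool | ∀ n, N ≤ n → |S n b| ≤ ε / 4} := by
    intro N
    simp only [Set.ofPred_forall]
    refine isClosed_iInter fun n => isClosed_iInter fun _ => isClosed_le ?_ continuous_const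
    refine continuous_abs.comp (continuous_finsetSum _ fun x _ => ?_)
    exact (continuous_of_discreteTopology (f := fun t : Bool => if t then w n x else 0)).comp
      (continuous_apply x)
  have hcover : ⋃ N, {b : ι → Bool | ∀ n, N ≤ n → |S n b| ≤ ε / 4} = Set.univ := by
    refine Set.eq_univ_of_forall fun b => Set.mem_iUnion.2 ?_
    obtain ⟨N, hN⟩ := Metric.tendsto_atTop.1 (h {x | b x = true}) (ε / 4) (by positivity)
    refine ⟨N, fun n hn => ?_⟩
    have := (hN n hn).le
    rw [Real.dist_eq, sub_zero] at this
    simpa only [hS, Set.indicator_apply, Set.mem_ofPred_eq] using this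
  obtain ⟨N, b₀, hb₀⟩ := nonempty_interior_of_iUnion_of_closed hclosed hcover
  obtain ⟨I, u, hu, hsub⟩ := isOpen_pi_iff.1 isOpen_interior b₀ hb₀
  have hagree : ∀ b : ι → Bool, (∀ i ∈ I, b i = b₀ i) → ∀ n, N ≤ n → |S n b| ≤ ε / 4 := by
    intro b hb
    refine interior_subset (hsub fun i hi => ?_)
    rw [hb i hi]
    exact (hu i hi).2
  have hI : Tendsto (fun n => ∑ i ∈ I, |∑ x ∈ s n, ({i} : Set ι).indicator (w n) x|)
      atTop (𝓝 0) := by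
    simpa using tendsto_finsetSum I fun i _ => (h {i}).abs
  obtain ⟨M, hM⟩ := Metric.tendsto_atTop.1 hI (ε / 2) (by positivity)
  refine ⟨max N M, fun n hn => ?_⟩
  have hfin := hM n (le_of_max_le_right hn)
  have hIeq : ∑ i ∈ I, |∑ x ∈ s n, ({i} : Set ι).indicator (w n) x|
      = ∑ x ∈ s n, if x ∈ I then |w n x| else 0 := by
    have : ∀ i, |∑ x ∈ s n, ({i} : Set ι).indicator (w n) x|
        = if i ∈ s n then |w n i| else 0 := by
      intro i
      simp only [Set.indicator_apply, Set.mem_singleton_iff, Finset.sum_ite_eq']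
      split_ifs <;> simp
    simp only [this]
    rw [← Finset.sum_filter, ← Finset.sum_filter, Finset.filter_mem_eq_inter,
      Finset.filter_mem_eq_inter, Finset.inter_comm]
  rw [hIeq, Real.dist_eq, sub_zero] at hfin
  have hpos := hagree (fun x => if x ∈ I then b₀ x else decide (0 ≤ w n x))
    (fun i hi => by simp [hi]) n (le_of_max_le_left hn)
  have hneg := hagree (fun x => if x ∈ I then b₀ x else decide (w n x < 0))
    (fun i hi => by simp [hi]) n (le_of_max_le_left hn)
  have hsplit : ∑ x ∈ s n, |w n x| = (∑ x ∈ s n, if x ∈ I then |w n x| else 0)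
      + (S n (fun x => if x ∈ I then b₀ x else decide (0 ≤ w n x))
        - S n (fun x => if x ∈ I then b₀ x else decide (w n x < 0))) := by
    rw [hS, ← Finset.sum_sub_distrib, ← Finset.sum_add_distrib]
    refine Finset.sum_congr rfl fun x _ => ?_
    by_cases hx : x ∈ I
    · simp [hx]
    · rcases le_or_gt 0 (w n x) with hw | hw
      · simp [hx, hw, abs_of_nonneg hw, not_lt.2 hw]
      · simp [hx, hw, abs_of_neg hw, not_le.2 hw]
  rw [Real.dist_eq, sub_zero, abs_of_nonneg (Finset.sum_nonneg fun x _ => abs_nonneg _), hsplit]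
  have h1 := (abs_lt.1 hfin).2
  have h2 := (abs_le.1 hpos).2
  have h3 := (abs_le.1 hneg).1
  linarith

theorem fsRestrNorm_nonneg (μ : Option ℕ →₀ ℝ) (B : Set (Option ℕ)) : 0 ≤ fsRestrNorm μ B :=
  Finset.sum_nonneg fun _ _ => Set.indicator_nonneg (fun _ _ => abs_nonneg _) _

theorem fsRestrNorm_mono (μ : Option ℕ →₀ ℝ) {B C : Set (Option ℕ)} (h : B ⊆ C) :
    fsRestrNorm μ B ≤ fsRestrNorm μ C :=
  Finset.sum_le_sum fun _ _ => Set.indicator_le_indicator_of_subset h (fun _ => abs_nonneg _) _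

theorem fsRestrNorm_union_le (μ : Option ℕ →₀ ℝ) (B C : Set (Option ℕ)) :
    fsRestrNorm μ (B ∪ C) ≤ fsRestrNorm μ B + fsRestrNorm μ C := by
  classical
  rw [fsRestrNorm, fsRestrNorm, fsRestrNorm, ← Finset.sum_add_distrib]
  refine Finset.sum_le_sum fun x _ => ?_
  have := abs_nonneg (μ x)
  by_cases hB : x ∈ B <;> by_cases hC : x ∈ C <;> simp [hB, hC]

theorem exists_support_bound (μ : Option ℕ →₀ ℝ) :
    ∃ m : ℕ, ∀ k : ℕ, some k ∈ μ.support → k ≤ m := by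
  obtain ⟨m, hm⟩ := (μ.support.eraseNone).bddAbove
  exact ⟨m, fun k hk => hm (by simpa using hk)⟩

theorem isClopen_some_image {F : Filter ℕ} {B : Set ℕ} (hB : Bᶜ ∈ F) :
    @IsClopen _ (NFTop F) (some '' B) := by
  let _ := NFTop F
  refine ⟨⟨fun _ => ?_⟩, fun h => by simp at h⟩
  convert hB using 1
  ext n
  simp

theorem IsANSeq.tendsto_fsRestrNorm {F : Filter ℕ} {μ : ℕ → (Option ℕ →₀ ℝ)}
    (h : IsANSeq F μ) {A : Set ℕ} (hA : Aᶜ ∈ F) :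
    Tendsto (fun n => fsRestrNorm (μ n) (some '' A)) atTop (𝓝 0) := by
  have key := tendsto_sum_abs_of_tendsto_sum_indicator (fun n => (μ n).support)
    (fun n => (some '' A : Set (Option ℕ)).indicator (μ n)) fun B => by
      simp only [Set.indicator_indicator]
      have hBA : B ∩ some '' A = some '' (some ⁻¹' B ∩ A) := by
        rw [Set.inter_comm, Set.inter_comm (some ⁻¹' B), Set.image_inter_preimage]
      rw [hBA]
      exact h.2 _ (isClopen_some_image
        (mem_of_superset hA (Set.compl_subset_compl.2 Set.inter_subset_right)))
  refine key.congr fun n => Finset.sum_congr rfl fun x _ => ?_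
  classical
  simp only [Set.indicator_apply]
  split_ifs <;> simp

/-- The mass at infinity is controlled by the mass on `ℕ`, so the latter is unbounded too. -/
theorem IsANSeq.tendsto_fsRestrNorm_range {F : Filter ℕ} {μ : ℕ → (Option ℕ →₀ ℝ)}
    (h : IsANSeq F μ) :
    Tendsto (fun n => fsRestrNorm (μ n) (some '' Set.univ)) atTop atTop := by
  classical
  have huniv := h.2 Set.univ (@isClopen_univ _ (NFTop F))
  have hle : ∀ n, fsNorm (μ n) ≤
      2 * fsRestrNorm (μ n) (some '' Set.univ) + |fsMeas (μ n) Set.univ| := by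
    intro n
    have htotal : fsMeas (μ n) Set.univ
        = (∑ x ∈ (μ n).support, if x = none then μ n x else 0)
          + ∑ x ∈ (μ n).support, (some '' Set.univ : Set (Option ℕ)).indicator (μ n) x := by
      rw [fsMeas, ← Finset.sum_add_distrib]
      refine Finset.sum_congr rfl fun x _ => ?_
      cases x <;> simp
    have hnorm : fsNorm (μ n)
        = |∑ x ∈ (μ n).support, if x = none then μ n x else 0|
          + fsRestrNorm (μ n) (some '' Set.univ) := by
      have : |∑ x ∈ (μ n).support, if x = none then μ n x else 0|
          = ∑ x ∈ (μ n).support, if x = none then |μ n x| else 0 := by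
        rw [Finset.sum_ite_eq', Finset.sum_ite_eq']
        split_ifs <;> simp
      rw [this, fsNorm, fsRestrNorm, ← Finset.sum_add_distrib]
      refine Finset.sum_congr rfl fun x _ => ?_
      cases x <;> simp
    have hsome : |∑ x ∈ (μ n).support, (some '' Set.univ : Set (Option ℕ)).indicator (μ n) x|
        ≤ fsRestrNorm (μ n) (some '' Set.univ) := by
      refine (Finset.abs_sum_le_sum_abs _ _).trans (Finset.sum_le_sum fun x _ => ?_)
      cases x <;> simp
    have htri := abs_sub (fsMeas (μ n) Set.univ)
      (∑ x ∈ (μ n).support, (some '' Set.univ : Set (Option ℕ)).indicator (μ n) x)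
    rw [eq_sub_of_add_eq htotal.symm] at hnorm
    linarith
  rw [tendsto_atTop]
  intro c
  have hev := Metric.tendsto_atTop.1 huniv 1 one_pos
  filter_upwards [h.1.eventually_ge_atTop (2 * c + 1), eventually_atTop.2 hev] with n h1 h2
  rw [Real.dist_eq, sub_zero] at h2
  linarith [hle n]

/-- The submeasure `A ↦ sup_n ‖μ_n ↾ A‖` on `ℕ`. -/
noncomputable def supVariation (μ : ℕ → (Option ℕ →₀ ℝ))
    (hfin : ∀ k : ℕ, BddAbove (Set.range fun n => fsRestrNorm (μ n) (some '' {k}))) :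
    Submeasure where
  toFun A := ⨆ n, ENNReal.ofReal (fsRestrNorm (μ n) (some '' A))
  empty' := by simp [fsRestrNorm]
  finite_singleton' k := by
    obtain ⟨c, hc⟩ := hfin k
    refine ne_top_of_le_ne_top ENNReal.ofReal_ne_top
      (iSup_le fun n => ENNReal.ofReal_le_ofReal (hc ⟨n, rfl⟩))
  mono' A B h := iSup_mono fun n =>
    ENNReal.ofReal_le_ofReal (fsRestrNorm_mono _ (Set.image_mono h))
  subadd' A B := iSup_le fun n => by
    rw [Set.image_union]
    refine (ENNReal.ofReal_le_ofReal (fsRestrNorm_union_le _ _ _)).trans ?_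
    rw [ENNReal.ofReal_add (fsRestrNorm_nonneg _ _) (fsRestrNorm_nonneg _ _)]
    exact add_le_add (le_iSup (fun n => ENNReal.ofReal (fsRestrNorm (μ n) (some '' A))) n)
      (le_iSup (fun n => ENNReal.ofReal (fsRestrNorm (μ n) (some '' B))) n)

theorem supVariation_lsc (μ : ℕ → (Option ℕ →₀ ℝ))
    (hfin : ∀ k : ℕ, BddAbove (Set.range fun n => fsRestrNorm (μ n) (some '' {k}))) :
    (supVariation μ hfin).LSC := by
  intro A
  have hmono : Monotone fun m : ℕ => (supVariation μ hfin).toFun (A ∩ Set.Iic m) :=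
    fun m m' h => (supVariation μ hfin).mono'
      (Set.inter_subset_inter_right A (Set.Iic_subset_Iic.2 h))
  convert tendsto_atTop_iSup hmono using 2
  refine le_antisymm (iSup_le fun n => ?_)
    (iSup_le fun m => (supVariation μ hfin).mono' Set.inter_subset_left)
  obtain ⟨m, hm⟩ := exists_support_bound (μ n)
  refine le_iSup_of_le m (le_iSup_of_le n (ENNReal.ofReal_le_ofReal (le_of_eq ?_)))
  classical
  refine Finset.sum_congr rfl fun x hx => ?_
  cases x with
  | none => simp
  | some k => simp [Set.indicator_apply, hm k hx]

theorem mem_Exh_supVariation (μ : ℕ → (Option ℕ →₀ ℝ))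
    (hfin : ∀ k : ℕ, BddAbove (Set.range fun n => fsRestrNorm (μ n) (some '' {k}))) {A : Set ℕ}
    (hA : Tendsto (fun n => fsRestrNorm (μ n) (some '' A)) atTop (𝓝 0)) :
    A ∈ Exh (supVariation μ hfin) := by
  refine ENNReal.tendsto_nhds_zero.2 fun ε hε => ?_
  have hA' : Tendsto (fun n => ENNReal.ofReal (fsRestrNorm (μ n) (some '' A))) atTop (𝓝 0) := by
    simpa using ENNReal.tendsto_ofReal hA
  obtain ⟨N, hN⟩ := eventually_atTop.1 (ENNReal.tendsto_nhds_zero.1 hA' ε hε)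
  choose m hm using fun n => exists_support_bound (μ n)
  filter_upwards [eventually_ge_atTop ((Finset.range N).sup m)] with M hM
  refine iSup_le fun n => ?_
  rcases le_or_gt N n with hn | hn
  · exact (ENNReal.ofReal_le_ofReal
      (fsRestrNorm_mono _ (Set.image_mono Set.sdiff_subset))).trans (hN n hn)
  · have hzero : fsRestrNorm (μ n) (some '' (A \ Set.Iic M)) = 0 := by
      refine Finset.sum_eq_zero fun x hx => Set.indicator_of_notMem ?_ _
      rintro ⟨k, hk, rfl⟩
      exact hk.2 ((hm n k hx).trans ((Finset.le_sup (Finset.mem_range.2 hn)).trans hM))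
    simp [hzero]

theorem supVariation_univ (μ : ℕ → (Option ℕ →₀ ℝ))
    (hfin : ∀ k : ℕ, BddAbove (Set.range fun n => fsRestrNorm (μ n) (some '' {k})))
    (h : Tendsto (fun n => fsRestrNorm (μ n) (some '' Set.univ)) atTop atTop) :
    (supVariation μ hfin).toFun Set.univ = ⊤ :=
  top_unique (le_of_tendsto' (ENNReal.tendsto_ofReal_atTop.comp h)
    fun n => le_iSup (fun n => ENNReal.ofReal (fsRestrNorm (μ n) (some '' Set.univ))) n)

/-- The pointwise sum of two submeasures. -/
noncomputable def Submeasure.add (φ ψ : Submeasure) : Submeasure where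
  toFun A := φ.toFun A + ψ.toFun A
  empty' := by simp [φ.empty', ψ.empty']
  finite_singleton' n := ENNReal.add_ne_top.2 ⟨φ.finite_singleton' n, ψ.finite_singleton' n⟩
  mono' _ _ h := add_le_add (φ.mono' h) (ψ.mono' h)
  subadd' A B := (add_le_add (φ.subadd' A B) (ψ.subadd' A B)).trans_eq (add_add_add_comm _ _ _ _)

theorem Submeasure.LSC.add {φ ψ : Submeasure} (hφ : φ.LSC) (hψ : ψ.LSC) : (φ.add ψ).LSC :=
  fun A => (hφ A).add (hψ A)

theorem Exh_add_of_subset {φ ψ : Submeasure} (h : Exh φ ⊆ Exh ψ) : Exh (φ.add ψ) = Exh φ := by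
  refine Set.Subset.antisymm (fun A hA => ?_) fun A hA => ?_
  · exact tendsto_of_tendsto_of_tendsto_of_le_of_le tendsto_const_nhds hA (fun _ => zero_le)
      fun _ => le_self_add
  · simpa [Exh, Submeasure.add] using Tendsto.add hA (h hA)

theorem singleton_mem_Exh (φ : Submeasure) (k : ℕ) : {k} ∈ Exh φ := by
  refine tendsto_const_nhds.congr' ?_
  filter_upwards [eventually_ge_atTop k] with m hm
  have hempty : ({k} : Set ℕ) \ Set.Iic m = ∅ :=
    Set.sdiff_eq_empty.2 (Set.singleton_subset_iff.2 hm)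
  rw [hempty, φ.empty']

theorem compl_mem_dualFilter {I : Set (Set ℕ)} {A : Set ℕ} (hA : A ∈ I) :
    Aᶜ ∈ dualFilter I :=
  mem_generate_of_mem (by simpa using hA)

/-- Corollary `tot_bounded`. If `I = Exh(φ)` for an lsc submeasure `φ` and
`I` is totally bounded (every lsc submeasure `ψ` with `Exh(ψ) = I` satisfies `ψ(ℕ) < ∞`),
then the dual filter `I*` has the Nikodym property. -/
theorem totally_bounded_implies_nikodym (φ : Submeasure) (hφ : φ.LSC)
    (htb : ∀ ψ : Submeasure, ψ.LSC → Exh ψ = Exh φ → ψ.toFun Set.univ ≠ ⊤) :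
    HasNikodymProp (dualFilter (Exh φ)) := by
  rintro ⟨μ, hμ⟩
  have hExh : ∀ A ∈ Exh φ, Tendsto (fun n => fsRestrNorm (μ n) (some '' A)) atTop (𝓝 0) :=
    fun A hA => hμ.tendsto_fsRestrNorm (compl_mem_dualFilter hA)
  have hfin : ∀ k : ℕ, BddAbove (Set.range fun n => fsRestrNorm (μ n) (some '' {k})) :=
    fun k => (hExh _ (singleton_mem_Exh φ k)).bddAbove_range
  refine htb (φ.add (supVariation μ hfin)) (hφ.add (supVariation_lsc μ hfin))
    (Exh_add_of_subset fun A hA => mem_Exh_supVariation μ hfin (hExh A hA)) ?_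
  simp [Submeasure.add, supVariation_univ μ hfin hμ.tendsto_fsRestrNorm_range]
end

section
/- Let λ be a nonnegative measure on a finite nonempty set A and let ε > 0. If μ is a nonnegative measure on a finite set B such that μ(B) = λ(A) and at⁺(μ) ≤ ε/(2|A|), then there exists a function f : B → A such that |λ(C) − μ(f⁻¹[C])| ≤ ε for every C ⊆ A. -/
open Filter Topology Set MeasureTheory
open scoped ENNReal NNReal

/-- Greedy assignment: atoms of mass at most `δ` and of total mass at most `∑ a, lam a` can be
distributed so that no fiber exceeds its prescribed mass by more than `δ`. -/
theorem exists_fiber_sum_le_add {A B : Type*} [Fintype A] [Nonempty A] [DecidableEq A]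
    {lam : A → ℝ} {mu : B → ℝ} {δ : ℝ} (hδ : 0 ≤ δ) (hlam : ∀ a, 0 ≤ lam a)
    (hmu : ∀ b, 0 ≤ mu b) (hatom : ∀ b, mu b ≤ δ) (s : Finset B)
    (hs : ∑ b ∈ s, mu b ≤ ∑ a, lam a) :
    ∃ f : B → A, ∀ a, ∑ b ∈ s with f b = a, mu b ≤ lam a + δ := by
  classical
  induction s using Finset.induction_on with
  | empty => exact ⟨fun _ => Classical.arbitrary A, fun a => by simpa using add_nonneg (hlam a) hδ⟩
  | insert b s hb ih =>
    rw [Finset.sum_insert hb] at hs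
    have hs' : ∑ x ∈ s, mu x ≤ ∑ a, lam a := by linarith [hmu b]
    obtain ⟨f, hf⟩ := ih hs'
    obtain ⟨a₀, -, ha₀⟩ : ∃ a ∈ Finset.univ, ∑ x ∈ s with f x = a, mu x ≤ lam a := by
      refine Finset.exists_le_of_sum_le Finset.univ_nonempty ?_
      rwa [Finset.sum_fiberwise]
    refine ⟨Function.update f b a₀, fun a => ?_⟩
    have hfib : ∑ x ∈ s with Function.update f b a₀ x = a, mu x = ∑ x ∈ s with f x = a, mu x := by
      congr 1
      refine Finset.filter_congr fun x hx => ?_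
      rw [Function.update_of_ne (ne_of_mem_of_not_mem hx hb)]
    rw [Finset.filter_insert, Function.update_self]
    split_ifs with h
    · subst h
      rw [Finset.sum_insert (by simp [hb]), hfib]
      linarith [hatom b]
    · rw [hfib]
      exact hf a

/-- If every fiber of `f` exceeds its prescribed mass by at most `δ`, then every preimage `f ⁻¹' C`
exceeds the mass of `C` by at most `|A| * δ`. -/
theorem sum_indicator_preimage_le {A B : Type*} [Fintype A] [Fintype B] [DecidableEq A]
    {lam : A → ℝ} {mu : B → ℝ} {δ : ℝ} (hδ : 0 ≤ δ) {f : B → A}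
    (hf : ∀ a, ∑ b with f b = a, mu b ≤ lam a + δ) (C : Set A) :
    ∑ b, (f ⁻¹' C).indicator mu b ≤ ∑ a, C.indicator lam a + Fintype.card A * δ := by
  classical
  calc ∑ b, (f ⁻¹' C).indicator mu b
      = ∑ a, ∑ b with f b = a, (f ⁻¹' C).indicator mu b := (Finset.sum_fiberwise _ _ _).symm
    _ = ∑ a, C.indicator (fun a => ∑ b with f b = a, mu b) a := by
      refine Finset.sum_congr rfl fun a _ => ?_
      by_cases ha : a ∈ C
      · rw [Set.indicator_of_mem ha]
        refine Finset.sum_congr rfl fun b hb => Set.indicator_of_mem ?_ _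
        simpa [(Finset.mem_filter.1 hb).2] using ha
      · rw [Set.indicator_of_notMem ha]
        refine Finset.sum_eq_zero fun b hb => Set.indicator_of_notMem ?_ _
        simpa [(Finset.mem_filter.1 hb).2] using ha
    _ ≤ ∑ a, (C.indicator lam a + δ) := by
      refine Finset.sum_le_sum fun a _ => ?_
      by_cases ha : a ∈ C
      · simpa [ha] using hf a
      · simpa [ha] using hδ
    _ = ∑ a, C.indicator lam a + Fintype.card A * δ := by
      simp [Finset.sum_add_distrib]

/-- Lemma `lem_katetov`. If `λ` is a nonnegative measure on a finite nonempty
set `A`, `ε > 0`, and `μ` is a nonnegative measure on a finite set `B` with `μ(B) = λ(A)` and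
`at⁺(μ) ≤ ε/(2|A|)`, then there is `f : B → A` with `|λ(C) − μ(f⁻¹[C])| ≤ ε` for all `C ⊆ A`. -/
theorem measure_transfer_lemma {A B : Type} [Fintype A] [Nonempty A] [Fintype B]
    (lam : A → ℝ) (mu : B → ℝ)
    (hlam : ∀ a, 0 ≤ lam a) (hmu : ∀ b, 0 ≤ mu b)
    (eps : ℝ) (heps : 0 < eps)
    (htot : ∑ b, mu b = ∑ a, lam a)
    (hatom : ∀ b, mu b ≤ eps / (2 * (Fintype.card A : ℝ))) :
    ∃ f : B → A, ∀ C : Set A,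
      |(∑ a, C.indicator lam a) - ∑ b, (f ⁻¹' C).indicator mu b| ≤ eps := by
  classical
  have hcard : (0 : ℝ) < Fintype.card A := by exact_mod_cast Fintype.card_pos
  have hδ : 0 ≤ eps / (2 * (Fintype.card A : ℝ)) := by positivity
  have hmul : (Fintype.card A : ℝ) * (eps / (2 * (Fintype.card A : ℝ))) = eps / 2 := by
    field_simp
  obtain ⟨f, hf⟩ := exists_fiber_sum_le_add hδ hlam hmu hatom Finset.univ htot.le
  refine ⟨f, fun C => ?_⟩
  have hC := sum_indicator_preimage_le hδ hf C
  have hCc := sum_indicator_preimage_le hδ hf Cᶜ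
  have hlamC : ∑ a, C.indicator lam a + ∑ a, Cᶜ.indicator lam a = ∑ a, lam a := by
    rw [← Finset.sum_add_distrib]
    exact Finset.sum_congr rfl fun a _ => Set.indicator_self_add_compl_apply C lam a
  have hmuC : ∑ b, (f ⁻¹' C).indicator mu b + ∑ b, (f ⁻¹' Cᶜ).indicator mu b = ∑ b, mu b := by
    rw [← Finset.sum_add_distrib]
    exact Finset.sum_congr rfl fun b _ => Set.indicator_self_add_compl_apply (f ⁻¹' C) mu b
  rw [hmul] at hC hCc
  rw [abs_le]
  constructor <;> linarith
end

section
/- Let (μ_n)_{n≥1} and (λ_n)_{n≥1} be sequences of finitely supported nonnegative measures on ℕ, each sequence disjointly supported (supports pairwise disjoint within each sequence), such that ‖μ_n‖ = ‖λ_n‖ = n for every n ≥ 1 and at⁺(μ_n) ≤ at⁻(λ_n)/(2n²) for all but finitely many n ≥ 1. Then Exh(sup_{n≥1} λ_n) ≤_K Exh(sup_{n≥1} μ_n). -/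
open Filter Topology Set MeasureTheory
open scoped ENNReal NNReal

/-- Greedy assignment: if every `a x` is at most every `b y`, and the total of `a` is at most the
total of `b`, then the `x`s can be distributed among the `y`s so that each fibre carries at most
`2 * b y`. -/
theorem exists_fiber_sum_le_two_mul (S T : Finset ℕ) (a b : ℕ → ℝ) (hT : T.Nonempty)
    (ha : ∀ x, 0 ≤ a x) (hb : ∀ y, 0 ≤ b y) (hab : ∀ x ∈ S, ∀ y ∈ T, a x ≤ b y)
    (hsum : ∑ x ∈ S, a x ≤ ∑ y ∈ T, b y) :
    ∃ g : ℕ → ℕ, (∀ x, g x ∈ T) ∧ ∀ y ∈ T, ∑ x ∈ S with g x = y, a x ≤ 2 * b y := by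
  induction S using Finset.induction_on with
  | empty =>
    obtain ⟨t, ht⟩ := hT
    exact ⟨fun _ => t, fun _ => ht, fun y _ => by simpa using hb y⟩
  | insert z S hz ih =>
    rw [Finset.sum_insert hz] at hsum
    obtain ⟨g, hgT, hg⟩ := ih (fun x hx => hab x (Finset.mem_insert_of_mem hx))
      (by linarith [ha z])
    obtain ⟨y, hyT, hy⟩ : ∃ y ∈ T, ∑ x ∈ S with g x = y, a x ≤ b y := by
      by_contra! hlt
      have hfib := Finset.sum_fiberwise_of_maps_to (s := S) (fun x _ => hgT x) a
      linarith [Finset.sum_lt_sum_of_nonempty hT hlt, ha z]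
    have hcongr (w : ℕ) :
        (S.filter fun x => Function.update g z y x = w) = S.filter fun x => g x = w :=
      Finset.filter_congr fun x hx => by
        rw [Function.update_of_ne (ne_of_mem_of_not_mem hx hz)]
    refine ⟨Function.update g z y, fun x => ?_, fun w hw => ?_⟩
    · by_cases hx : x = z
      · simpa [hx] using hyT
      · simpa [hx] using hgT x
    · rw [Finset.filter_insert, hcongr, Function.update_self]
      split_ifs with hyw
      · subst hyw
        rw [Finset.sum_insert (by simp [hz])]
        linarith [hab z (Finset.mem_insert_self z S) y hyT]
      · exact hg w hw

theorem natMeas_nonneg {ν : ℕ →₀ ℝ} (hν : ∀ x, 0 ≤ ν x) (A : Set ℕ) : 0 ≤ natMeas ν A :=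
  Finset.sum_nonneg fun x _ => Set.indicator_nonneg (fun y _ => hν y) x

theorem natMeas_congr {ν : ℕ →₀ ℝ} {A B : Set ℕ} (h : ∀ x ∈ ν.support, x ∈ A ↔ x ∈ B) :
    natMeas ν A = natMeas ν B :=
  Finset.sum_congr rfl fun x hx => by
    classical
    simp only [Set.indicator_apply, h x hx]

theorem natMeas_mono {ν : ℕ →₀ ℝ} (hν : ∀ x, 0 ≤ ν x) {A B : Set ℕ} (h : A ⊆ B) :
    natMeas ν A ≤ natMeas ν B :=
  Finset.sum_le_sum fun x _ => Set.indicator_le_indicator_of_subset h hν x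

theorem natNorm_eq_sum {ν : ℕ →₀ ℝ} (hν : ∀ x, 0 ≤ ν x) :
    natNorm ν = ∑ x ∈ ν.support, ν x :=
  Finset.sum_congr rfl fun x _ => abs_of_nonneg (hν x)

theorem le_atPlus {ν : ℕ →₀ ℝ} {x : ℕ} (hx : x ∈ ν.support) : ν x ≤ atPlus ν :=
  le_csSup (ν.support.finite_toSet.image _).bddAbove (Set.mem_image_of_mem _ hx)

theorem atMinus_le {ν : ℕ →₀ ℝ} {x : ℕ} (hx : x ∈ ν.support) : atMinus ν ≤ ν x :=
  csInf_le (ν.support.finite_toSet.image _).bddBelow (Set.mem_image_of_mem _ hx)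

theorem atMinus_nonneg {ν : ℕ →₀ ℝ} (hν : ∀ x, 0 ≤ ν x) : 0 ≤ atMinus ν :=
  Real.sInf_nonneg (by rintro _ ⟨x, -, rfl⟩; exact hν x)

theorem natMeas_preimage_le {μ ν : ℕ →₀ ℝ} {g : ℕ → ℕ} {c : ℝ}
    (hg : ∀ x ∈ μ.support, g x ∈ ν.support)
    (hfib : ∀ y ∈ ν.support, ∑ x ∈ μ.support with g x = y, μ x ≤ c * ν y) (A : Set ℕ) :
    natMeas μ (g ⁻¹' A) ≤ c * natMeas ν A := by
  classical
  unfold natMeas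
  rw [← Finset.sum_fiberwise_of_maps_to hg, Finset.mul_sum]
  refine Finset.sum_le_sum fun y hy => ?_
  by_cases hyA : y ∈ A
  · rw [Set.indicator_of_mem hyA]
    refine le_trans (le_of_eq (Finset.sum_congr rfl fun x hx => ?_)) (hfib y hy)
    refine Set.indicator_of_mem ?_ _
    simpa [(Finset.mem_filter.1 hx).2] using hyA
  · rw [Set.indicator_of_notMem hyA, mul_zero]
    refine (Finset.sum_eq_zero fun x hx => Set.indicator_of_notMem ?_ _).le
    simpa [(Finset.mem_filter.1 hx).2] using hyA

/-- Pairwise disjoint finite sets eventually leave every initial segment. -/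
theorem eventually_forall_mem_lt {S : ℕ → Finset ℕ}
    (hS : ∀ m n, m ≠ n → Disjoint (S m) (S n)) (k : ℕ) :
    ∀ᶠ n in atTop, ∀ x ∈ S n, k < x := by
  have hpt (x : ℕ) : ∀ᶠ n in atTop, x ∉ S n := by
    by_cases hx : ∃ m, x ∈ S m
    · obtain ⟨m, hm⟩ := hx
      filter_upwards [eventually_gt_atTop m] with n hn hxn
      exact Finset.disjoint_left.1 (hS m n hn.ne) hm hxn
    · exact Eventually.of_forall fun n hn => hx ⟨n, hn⟩
  have hall := (Set.finite_Iic k).eventually_all.2 fun x _ => hpt x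
  filter_upwards [hall] with n hn x hx
  by_contra! hxk
  exact hn x hxk hx

/-- For disjointly supported measures, membership in `Exh (sup_n ν_n)` means `ν_n(A) → 0`. -/
theorem mem_ExhSupPos_iff {ν : ℕ → (ℕ →₀ ℝ)} (hν : ∀ n x, 0 ≤ ν n x)
    (hdisj : ∀ m n, 1 ≤ m → 1 ≤ n → m ≠ n → Disjoint (ν m).support (ν n).support) (A : Set ℕ) :
    A ∈ ExhSupPos ν ↔ Tendsto (fun n => natMeas (ν (n + 1)) A) atTop (𝓝 0) := by
  have hiff : Tendsto (fun n => natMeas (ν (n + 1)) A) atTop (𝓝 0) ↔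
      Tendsto (fun n => ENNReal.ofReal (natMeas (ν (n + 1)) A)) atTop (𝓝 0) := by
    refine ⟨fun h => by simpa using ENNReal.tendsto_ofReal h, fun h => ?_⟩
    have h' := (ENNReal.tendsto_toReal ENNReal.zero_ne_top).comp h
    simpa [Function.comp_def, ENNReal.toReal_ofReal (natMeas_nonneg (hν _) A)] using h'
  rw [hiff]
  unfold ExhSupPos
  rw [Set.mem_ofPred_eq, ENNReal.tendsto_nhds_zero, ENNReal.tendsto_nhds_zero]
  refine forall₂_congr fun ε _ => ⟨fun h => ?_, fun h => ?_⟩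
  · obtain ⟨k, hk⟩ := h.exists
    filter_upwards [eventually_forall_mem_lt (S := fun n => (ν (n + 1)).support)
      (fun m n hmn => hdisj _ _ (by omega) (by omega) (by omega)) k] with n hn
    have hcut : natMeas (ν (n + 1)) A = natMeas (ν (n + 1)) (A \ Set.Iic k) :=
      natMeas_congr fun x hx => by simp [hn x hx]
    rw [hcut]
    exact (le_iSup (fun n => ENNReal.ofReal (natMeas (ν (n + 1)) (A \ Set.Iic k))) n).trans hk
  · obtain ⟨N, hN⟩ := eventually_atTop.1 h
    obtain ⟨M, hM⟩ := ((Finset.range N).biUnion fun n => (ν (n + 1)).support).bddAbove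
    filter_upwards [eventually_ge_atTop M] with k hk
    refine iSup_le fun n => ?_
    rcases lt_or_ge n N with hn | hn
    · have hempty : natMeas (ν (n + 1)) (A \ Set.Iic k) = 0 := by
        refine Finset.sum_eq_zero fun x hx => Set.indicator_of_notMem (fun hxA => hxA.2 ?_) _
        exact (hM (Finset.mem_coe.2 (Finset.mem_biUnion.2
          ⟨n, Finset.mem_range.2 hn, hx⟩))).trans hk
      simp [hempty]
    · exact (ENNReal.ofReal_le_ofReal (natMeas_mono (hν _) Set.sdiff_subset)).trans (hN n hn)

/-- Lemma `katetov_max`. If `(μ_n)_{n≥1}` and `(λ_n)_{n≥1}` are disjointly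
supported sequences of finitely supported nonnegative measures on `ℕ` with `‖μ_n‖ = ‖λ_n‖ = n`
and `at⁺(μ_n) ≤ at⁻(λ_n)/(2n²)` for all but finitely many `n`, then
`Exh(sup_{n≥1} λ_n) ≤_K Exh(sup_{n≥1} μ_n)`. -/
theorem exhSup_katetov_of_atoms (μ lam : ℕ → (ℕ →₀ ℝ))
    (hμpos : ∀ n x, 0 ≤ μ n x) (hlampos : ∀ n x, 0 ≤ lam n x)
    (hμdisj : ∀ m n, 1 ≤ m → 1 ≤ n → m ≠ n → Disjoint (μ m).support (μ n).support)
    (hlamdisj : ∀ m n, 1 ≤ m → 1 ≤ n → m ≠ n → Disjoint (lam m).support (lam n).support)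
    (hμnorm : ∀ n, 1 ≤ n → natNorm (μ n) = n)
    (hlamnorm : ∀ n, 1 ≤ n → natNorm (lam n) = n)
    (hatom : ∀ᶠ n in atTop, atPlus (μ n) ≤ atMinus (lam n) / (2 * (n : ℝ) ^ 2)) :
    KatLE (ExhSupPos lam) (ExhSupPos μ) := by
  have hloc : ∀ᶠ n in atTop, ∃ g : ℕ → ℕ, (∀ x, g x ∈ (lam n).support) ∧
      ∀ y ∈ (lam n).support, ∑ x ∈ (μ n).support with g x = y, μ n x ≤ 2 * lam n y := by
    filter_upwards [hatom, eventually_ge_atTop 1] with n hn h1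
    have hn1 : (1 : ℝ) ≤ n := by exact_mod_cast h1
    have hμsum := natNorm_eq_sum (hμpos n)
    have hlamsum := natNorm_eq_sum (hlampos n)
    rw [hμnorm n h1] at hμsum
    rw [hlamnorm n h1] at hlamsum
    have hne : (lam n).support.Nonempty := by
      by_contra hempty
      rw [Finset.not_nonempty_iff_eq_empty.1 hempty, Finset.sum_empty] at hlamsum
      linarith
    refine exists_fiber_sum_le_two_mul _ _ _ _ hne (hμpos n) (hlampos n) (fun x hx y hy => ?_)
      (hμsum.symm.trans hlamsum).le
    calc μ n x ≤ atPlus (μ n) := le_atPlus hx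
      _ ≤ atMinus (lam n) / (2 * (n : ℝ) ^ 2) := hn
      _ ≤ atMinus (lam n) := div_le_self (atMinus_nonneg (hlampos n)) (by nlinarith)
      _ ≤ lam n y := atMinus_le hy
  obtain ⟨N, hN⟩ := eventually_atTop.1 hloc
  choose! g hg hfib using hN
  obtain ⟨i, hi⟩ : ∃ i : ℕ → ℕ, ∀ n, 1 ≤ n → ∀ x ∈ (μ n).support, i x = n := by
    have huniq (x : ℕ) : ∃ k, ∀ n, 1 ≤ n → x ∈ (μ n).support → k = n := by
      by_cases hx : ∃ k, 1 ≤ k ∧ x ∈ (μ k).support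
      · obtain ⟨k, hk, hxk⟩ := hx
        refine ⟨k, fun n hn hxn => ?_⟩
        by_contra hkn
        exact Finset.disjoint_left.1 (hμdisj k n hk hn hkn) hxk hxn
      · exact ⟨0, fun n hn hxn => absurd ⟨n, hn, hxn⟩ hx⟩
    choose i hi using huniq
    exact ⟨i, fun n hn x hx => hi x n hn hx⟩
  refine ⟨fun x => g (i x) x, fun A hA => ?_⟩
  rw [mem_ExhSupPos_iff hlampos hlamdisj] at hA
  rw [mem_ExhSupPos_iff hμpos hμdisj]
  refine squeeze_zero' (Eventually.of_forall fun n => natMeas_nonneg (hμpos _) _) ?_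
    (by simpa using hA.const_mul 2)
  filter_upwards [eventually_ge_atTop N] with n hn
  have hcongr : natMeas (μ (n + 1)) ((fun x => g (i x) x) ⁻¹' A) =
      natMeas (μ (n + 1)) (g (n + 1) ⁻¹' A) :=
    natMeas_congr fun x hx => by simp [hi (n + 1) (by omega) x hx]
  rw [hcongr]
  exact natMeas_preimage_le (fun x _ => hg (n + 1) (by omega) x) (hfib (n + 1) (by omega)) A
end

section
/- If a free filter F on ω does not have the Nikodym property, then F has the bounded Josefson–Nissenzweig property (BJNP): there is a sequence (λ_n) of finitely supported signed measures on N_F with ‖λ_n‖ = 1 for every n and ∫ f dλ_n → 0 for every bounded continuous function f : N_F → ℝ. -/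
open Filter Topology Set MeasureTheory
open scoped ENNReal NNReal

theorem fsNorm_smul {c : ℝ} (hc : c ≠ 0) (μ : Option ℕ →₀ ℝ) :
    fsNorm (c • μ) = |c| * fsNorm μ := by
  unfold fsNorm
  rw [Finsupp.support_smul_eq hc, Finset.mul_sum]
  simp [abs_mul]

theorem fsMeas_smul {c : ℝ} (hc : c ≠ 0) (μ : Option ℕ →₀ ℝ) (A : Set (Option ℕ)) :
    fsMeas (c • μ) A = c * fsMeas μ A := by
  unfold fsMeas
  rw [Finsupp.support_smul_eq hc, Finset.mul_sum]
  refine Finset.sum_congr rfl fun x _ => ?_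
  by_cases hx : x ∈ A <;> simp [hx]

/-- The integral of a function with finitely many values, as a sum over its level sets. -/
theorem fsInteg_eq_sum_level (μ : Option ℕ →₀ ℝ) (g : Option ℕ → ℝ) (T : Finset ℝ)
    (hT : ∀ x, g x ∈ T) :
    fsInteg μ g = ∑ v ∈ T, v * fsMeas μ (g ⁻¹' {v}) := by
  unfold fsInteg fsMeas
  simp_rw [Finset.mul_sum]
  rw [Finset.sum_comm]
  refine Finset.sum_congr rfl fun x _ => ?_
  rw [Finset.sum_eq_single_of_mem (g x) (hT x)]
  · simp [mul_comm]
  · intro v _ hv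
    simp [Set.indicator, hv.symm]

theorem abs_fsInteg_sub_le (μ : Option ℕ →₀ ℝ) (f g : Option ℕ → ℝ) {ε : ℝ}
    (hfg : ∀ x, |f x - g x| ≤ ε) :
    |fsInteg μ f - fsInteg μ g| ≤ ε * fsNorm μ := by
  unfold fsInteg fsNorm
  rw [← Finset.sum_sub_distrib, Finset.mul_sum]
  refine (Finset.abs_sum_le_sum_abs _ _).trans (Finset.sum_le_sum fun x _ => ?_)
  rw [← mul_sub, abs_mul, mul_comm]
  exact mul_le_mul_of_nonneg_right (hfg x) (abs_nonneg _)

/-- Level sets of a function that is constant on an open neighbourhood of `p_F` are clopen. -/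
theorem isClopen_level_of_const_nhds {F : Filter ℕ} {U : Set (Option ℕ)}
    (hU : IsOpen[NFTop F] U) (hnone : none ∈ U) {g : Option ℕ → ℝ} {c : ℝ}
    (hg : ∀ x ∈ U, g x = c) (v : ℝ) : @IsClopen _ (NFTop F) (g ⁻¹' {v}) := by
  have key : ∀ S : Set ℝ, IsOpen[NFTop F] (g ⁻¹' S) := fun S hS =>
    Filter.mem_of_superset (hU hnone) fun n hn => by
      have hc : c ∈ S := hg none hnone ▸ hS
      simpa [hg _ hn] using hc
  let _ := NFTop F
  exact ⟨⟨by simpa using key {v}ᶜ⟩, key {v}⟩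

/-- A bounded continuous function on `N_F` is uniformly approximated by functions with finitely
many values and clopen level sets. -/
theorem exists_clopen_simple_approx {F : Filter ℕ} {f : Option ℕ → ℝ}
    (hf : @Continuous _ _ (NFTop F) _ f) {C : ℝ} (hC : ∀ x, |f x| ≤ C) {ε : ℝ} (hε : 0 < ε) :
    ∃ (g : Option ℕ → ℝ) (T : Finset ℝ), (∀ x, g x ∈ T) ∧ (∀ x, |f x - g x| ≤ ε) ∧
      ∀ v, @IsClopen _ (NFTop F) (g ⁻¹' {v}) := by
  classical
  set U : Set (Option ℕ) := f ⁻¹' Metric.ball (f none) ε with hUdef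
  have hU : IsOpen[NFTop F] U := (@continuous_def _ _ (NFTop F) _ f).1 hf _ Metric.isOpen_ball
  have hnone : none ∈ U := by simpa [hUdef] using hε
  refine ⟨fun x => if x ∈ U then f none else ε * ⌊f x / ε⌋,
    insert (f none) ((Finset.Icc ⌊-C / ε⌋ ⌊C / ε⌋).image fun k : ℤ => ε * (k : ℝ)),
    fun x => ?_, fun x => ?_,
    isClopen_level_of_const_nhds hU hnone (c := f none) fun x hx => if_pos hx⟩
  · by_cases hx : x ∈ U
    · simp [hx]
    · simp only [hx, if_false]
      refine Finset.mem_insert_of_mem (Finset.mem_image_of_mem _ (Finset.mem_Icc.2 ⟨?_, ?_⟩)) <;>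
        refine Int.floor_le_floor (div_le_div_of_nonneg_right ?_ hε.le)
      · exact (abs_le.1 (hC x)).1
      · exact (abs_le.1 (hC x)).2
  · by_cases hx : x ∈ U
    · simp only [hx, if_true]
      exact (show |f x - f none| < ε from hx).le
    · simp only [hx, if_false]
      have h1 := Int.floor_le (f x / ε)
      have h2 := Int.lt_floor_add_one (f x / ε)
      rw [le_div_iff₀ hε] at h1
      rw [div_lt_iff₀ hε] at h2
      rw [abs_le]
      constructor <;> nlinarith

/-- A norm-bounded sequence of measures vanishing asymptotically on clopen sets converges to zero
against every bounded continuous function. -/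
theorem tendsto_fsInteg_of_tendsto_clopen {F : Filter ℕ} {lam : ℕ → (Option ℕ →₀ ℝ)}
    (hnorm : ∀ n, fsNorm (lam n) ≤ 1)
    (hclopen : ∀ A : Set (Option ℕ), @IsClopen _ (NFTop F) A →
      Tendsto (fun n => fsMeas (lam n) A) atTop (nhds 0))
    {f : Option ℕ → ℝ} (hf : @Continuous _ _ (NFTop F) _ f) {C : ℝ} (hC : ∀ x, |f x| ≤ C) :
    Tendsto (fun n => fsInteg (lam n) f) atTop (nhds 0) := by
  rw [Metric.tendsto_nhds]
  intro ε hε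
  obtain ⟨g, T, hT, hfg, hg⟩ := exists_clopen_simple_approx hf hC (half_pos hε)
  have hlim : Tendsto (fun n => fsInteg (lam n) g) atTop (nhds 0) := by
    simp_rw [fsInteg_eq_sum_level _ g T hT]
    simpa using tendsto_finsetSum T fun v _ => (hclopen _ (hg v)).const_mul v
  filter_upwards [Metric.tendsto_nhds.1 hlim _ (half_pos hε)] with n hn
  have h1 := abs_fsInteg_sub_le (lam n) f g hfg
  have h2 : ε / 2 * fsNorm (lam n) ≤ ε / 2 := mul_le_of_le_one_right (half_pos hε).le (hnorm n)
  rw [Real.dist_eq, sub_zero] at hn ⊢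
  have h3 := abs_sub_abs_le_abs_sub (fsInteg (lam n) f) (fsInteg (lam n) g)
  linarith

/-- Proposition `nikodym_bjn`. If a free filter `F` on `ω` does not have the
Nikodym property, then it has the bounded Josefson–Nissenzweig property: there is a sequence
`(λ_n)` of finitely supported signed measures on `N_F` with `‖λ_n‖ = 1` and `∫ f dλ_n → 0`
for every bounded continuous `f : N_F → ℝ`. -/
theorem not_nikodym_implies_BJNP (F : Filter ℕ)
    (hfree : F ≤ Filter.cofinite) (hne : F.NeBot)
    (h : ¬ HasNikodymProp F) :
    ∃ lam : ℕ → (Option ℕ →₀ ℝ),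
      (∀ n, fsNorm (lam n) = 1) ∧
      ∀ f : Option ℕ → ℝ, @Continuous _ _ (NFTop F) _ f → (∃ C : ℝ, ∀ x, |f x| ≤ C) →
        Tendsto (fun n => fsInteg (lam n) f) atTop (nhds 0) := by
  obtain ⟨μ, hμ, hclopen⟩ := not_not.1 h
  obtain ⟨N, hN⟩ := eventually_atTop.1 (hμ.eventually_gt_atTop 0)
  have hpos : ∀ n, 0 < fsNorm (μ (n + N)) := fun n => hN _ (Nat.le_add_left N n)
  have hne0 : ∀ n, (fsNorm (μ (n + N)))⁻¹ ≠ 0 := fun n => inv_ne_zero (hpos n).ne'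
  have hnorm : ∀ n, fsNorm ((fsNorm (μ (n + N)))⁻¹ • μ (n + N)) = 1 := fun n => by
    rw [fsNorm_smul (hne0 n), abs_of_pos (inv_pos.2 (hpos n)), inv_mul_cancel₀ (hpos n).ne']
  refine ⟨fun n => (fsNorm (μ (n + N)))⁻¹ • μ (n + N), hnorm, fun f hf ⟨C, hC⟩ =>
    tendsto_fsInteg_of_tendsto_clopen (fun n => (hnorm n).le) (fun A hA => ?_) hf hC⟩
  simp_rw [fsMeas_smul (hne0 _)]
  have hshift := tendsto_add_atTop_nat N
  simpa using (hμ.comp hshift).inv_tendsto_atTop.mul ((hclopen A hA).comp hshift)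
end

section
/- Let f : ℕ → [0,∞) satisfy Σ_{n∈ℕ} f(n) = ∞, and let I_f = {A ⊆ ℕ : Σ_{n∈A} f(n) < ∞} be the corresponding summable ideal. Then the dual filter (I_f)* does not have the Nikodym property. -/
open Filter Topology Set MeasureTheory
open scoped ENNReal NNReal

/-- A set in the dual filter of a summable ideal has its complement in the ideal. -/
theorem summable_indicator_compl_of_mem_dualFilter {f : ℕ → ℝ} {A : Set ℕ}
    (hA : A ∈ dualFilter {A : Set ℕ | Summable (A.indicator f)}) :
    Summable (Aᶜ.indicator f) := by
  have summable_mono : ∀ {B C : Set ℕ}, B ⊆ C → Summable (C.indicator f) →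
      Summable (B.indicator f) := fun {B C} hBC hC => by
    simpa only [Set.indicator_indicator, Set.inter_eq_left.2 hBC] using hC.indicator B
  let G : Filter ℕ :=
    { sets := {A : Set ℕ | Summable (Aᶜ.indicator f)}
      univ_sets := by simp [summable_zero]
      sets_of_superset := fun hx hxy => summable_mono (Set.compl_subset_compl.2 hxy) hx
      inter_sets := fun {x y} hx hy => by
        have hy' : Summable ((yᶜ \ xᶜ).indicator f) := summable_mono Set.sdiff_subset hy
        have h := Summable.add hx hy'
        rw [← Set.indicator_union_of_disjoint Set.disjoint_sdiff_right, Set.union_sdiff_self] at h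
        simpa only [Set.mem_ofPred_eq, Set.compl_inter] using h }
  have hG : G ≤ dualFilter {A : Set ℕ | Summable (A.indicator f)} :=
    Filter.le_generate_iff.2 fun _ hB => hB
  exact hG hA

/-- The measure with weights `f` on the finite set `s ⊆ ℕ`, balanced to total mass zero by an
atom at `none`. -/
noncomputable def balancedMeas (f : ℕ → ℝ) (s : Finset ℕ) : Option ℕ →₀ ℝ :=
  Finsupp.onFinset s.insertNone
    (fun x => x.elim (-∑ k ∈ s, f k) ((s : Set ℕ).indicator f)) fun x hx => by
      cases x with
      | none => simp
      | some k => exact Finset.some_mem_insertNone.2 (Set.mem_of_indicator_ne_zero hx)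

theorem balancedMeas_none (f : ℕ → ℝ) (s : Finset ℕ) :
    balancedMeas f s none = -∑ k ∈ s, f k := rfl

theorem balancedMeas_some (f : ℕ → ℝ) {s : Finset ℕ} {k : ℕ} (hk : k ∈ s) :
    balancedMeas f s (some k) = f k :=
  Set.indicator_of_mem (Finset.mem_coe.2 hk) f

theorem fsMeas_balancedMeas (f : ℕ → ℝ) (s : Finset ℕ) (A : Set (Option ℕ)) :
    fsMeas (balancedMeas f s) A =
      A.indicator (balancedMeas f s) none + ∑ k ∈ s, (some ⁻¹' A).indicator f k := by
  have h : fsMeas (balancedMeas f s) A =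
      ∑ x ∈ s.insertNone, A.indicator (balancedMeas f s) x :=
    Finset.sum_subset Finsupp.support_onFinset_subset fun x _ hx => by
      simp [Finsupp.notMem_support_iff.1 hx]
  rw [h, Finset.sum_insertNone]
  congr 1
  refine Finset.sum_congr rfl fun k hk => ?_
  classical
  simp only [Set.indicator_apply, Set.mem_preimage, balancedMeas_some f hk]

theorem fsMeas_balancedMeas_of_none_notMem (f : ℕ → ℝ) (s : Finset ℕ) {A : Set (Option ℕ)}
    (hA : none ∉ A) :
    fsMeas (balancedMeas f s) A = ∑ k ∈ s, (some ⁻¹' A).indicator f k := by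
  rw [fsMeas_balancedMeas, Set.indicator_of_notMem hA, zero_add]

theorem fsMeas_balancedMeas_of_none_mem (f : ℕ → ℝ) (s : Finset ℕ) {A : Set (Option ℕ)}
    (hA : none ∈ A) :
    fsMeas (balancedMeas f s) A = -∑ k ∈ s, (some ⁻¹' A)ᶜ.indicator f k := by
  rw [fsMeas_balancedMeas, Set.indicator_of_mem hA, balancedMeas_none, neg_add_eq_sub,
    ← Finset.sum_sub_distrib, ← Finset.sum_neg_distrib]
  refine Finset.sum_congr rfl fun k _ => ?_
  rw [Set.indicator_compl, Pi.sub_apply, neg_sub]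

theorem sum_le_fsNorm_balancedMeas (f : ℕ → ℝ) (s : Finset ℕ) :
    ∑ k ∈ s, f k ≤ fsNorm (balancedMeas f s) := by
  by_cases h : none ∈ (balancedMeas f s).support
  · calc ∑ k ∈ s, f k ≤ |balancedMeas f s none| := by
          rw [balancedMeas_none, abs_neg]; exact le_abs_self _
      _ ≤ _ := Finset.single_le_sum (f := fun x => |balancedMeas f s x|)
          (fun _ _ => abs_nonneg _) h
  · rw [Finsupp.notMem_support_iff, balancedMeas_none, neg_eq_zero] at h
    rw [h]
    exact Finset.sum_nonneg fun _ _ => abs_nonneg _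

/-- The sums of a summable series over intervals moving off to infinity tend to zero. -/
theorem Summable.tendsto_sum_Ico_zero {g : ℕ → ℝ} (hg : Summable g) {b : ℕ → ℕ}
    (hb : ∀ n, n ≤ b n) :
    Tendsto (fun n => ∑ k ∈ Finset.Ico n (b n), g k) atTop (nhds 0) := by
  have h := hg.hasSum.tendsto_sum_nat
  have hb' : Tendsto b atTop atTop := tendsto_atTop_mono hb tendsto_id
  simpa only [Finset.sum_Ico_eq_sub g (hb _), sub_self, Function.comp_def]
    using (h.comp hb').sub h

/-- Corollary `summable`. For `f : ℕ → [0,∞)` with `Σ_n f(n) = ∞`, the dual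
filter of the summable ideal `I_f = {A : Σ_{n ∈ A} f(n) < ∞}` does not have the Nikodym
property. -/
theorem summable_ideal_dual_not_nikodym (f : ℕ → ℝ)
    (hf : ∀ n, 0 ≤ f n) (hdiv : ¬ Summable f) :
    ¬ HasNikodymProp (dualFilter {A : Set ℕ | Summable (A.indicator f)}) := by
  have htop := (not_summable_iff_tendsto_nat_atTop_of_nonneg hf).1 hdiv
  have hex : ∀ n : ℕ, ∃ m, n ≤ m ∧ (n : ℝ) ≤ ∑ k ∈ Finset.Ico n m, f k := fun n => by
    obtain ⟨m, hm, hnm⟩ := ((htop.eventually_ge_atTop (n + ∑ k ∈ Finset.range n, f k)).and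
      (eventually_ge_atTop n)).exists
    refine ⟨m, hnm, ?_⟩
    rw [Finset.sum_Ico_eq_sub f hnm]
    linarith
  choose b hb hbsum using hex
  refine not_not_intro ⟨fun n => balancedMeas f (Finset.Ico n (b n)), ?_, fun A hA => ?_⟩
  · exact tendsto_atTop_mono (fun n => (hbsum n).trans (sum_le_fsNorm_balancedMeas _ _))
      tendsto_natCast_atTop_atTop
  · by_cases hnone : none ∈ A
    · have hs : Summable ((some ⁻¹' A)ᶜ.indicator f) :=
        summable_indicator_compl_of_mem_dualFilter (hA.2 hnone)
      simpa only [fsMeas_balancedMeas_of_none_mem f _ hnone, neg_zero]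
        using (hs.tendsto_sum_Ico_zero hb).neg
    · have hs := summable_indicator_compl_of_mem_dualFilter (hA.1.1 hnone)
      have hcompl : {n : ℕ | some n ∈ Aᶜ}ᶜ = some ⁻¹' A := compl_compl (some ⁻¹' A)
      rw [hcompl] at hs
      simpa only [fsMeas_balancedMeas_of_none_notMem f _ hnone]
        using hs.tendsto_sum_Ico_zero hb
end

section
/- Let X be a compact Hausdorff zero-dimensional space and let A be the Boolean algebra of clopen subsets of X. Let G be a free filter on ω that does not have the Nikodym property. If N_G embeds homeomorphically into X, then A does not have the Nikodym property: there is a sequence (λ_n) of finitely additive signed measures of bounded variation on A which is pointwise bounded (sup_n |λ_n(a)| < ∞ for every a ∈ A) but not uniformly bounded (sup_n ‖λ_n‖ = ∞). -/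
open Filter Topology Set MeasureTheory
open scoped ENNReal NNReal

theorem fsMeas_union (μ : Option ℕ →₀ ℝ) {A B : Set (Option ℕ)} (h : Disjoint A B) :
    fsMeas μ (A ∪ B) = fsMeas μ A + fsMeas μ B := by
  unfold fsMeas
  rw [← Finset.sum_add_distrib]
  exact Finset.sum_congr rfl fun x _ => by rw [Set.indicator_union_of_disjoint h]

theorem abs_fsMeas_le (μ : Option ℕ →₀ ℝ) (A : Set (Option ℕ)) : |fsMeas μ A| ≤ fsNorm μ := by
  refine (Finset.abs_sum_le_sum_abs _ _).trans (Finset.sum_le_sum fun x _ => ?_)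
  by_cases hx : x ∈ A <;> simp [hx]

/-- A set containing the positive atoms and missing the negative ones, together with its
complement, witnesses at least the full norm. -/
theorem fsNorm_le_of_separates (μ : Option ℕ →₀ ℝ) {A : Set (Option ℕ)}
    (hpos : ∀ x, 0 < μ x → x ∈ A) (hneg : ∀ x, μ x < 0 → x ∉ A) :
    fsNorm μ ≤ |fsMeas μ A| + |fsMeas μ Aᶜ| := by
  have key : fsNorm μ = fsMeas μ A - fsMeas μ Aᶜ := by
    unfold fsNorm fsMeas
    rw [← Finset.sum_sub_distrib]
    refine Finset.sum_congr rfl fun x _ => ?_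
    by_cases hx : x ∈ A
    · have h : 0 ≤ μ x := not_lt.mp fun h => hneg x h hx
      simp [hx, abs_of_nonneg h]
    · have h : μ x ≤ 0 := not_lt.mp fun h => hx (hpos x h)
      simp [hx, abs_of_nonpos h]
  linarith [le_abs_self (fsMeas μ A), neg_le_abs (fsMeas μ Aᶜ)]

theorem exists_isClopen_separating_finsets {ι X : Type*} [TopologicalSpace X] [T1Space X]
    (hbasis : TopologicalSpace.IsTopologicalBasis {U : Set X | IsClopen U})
    {e : ι → X} (he : Function.Injective e) {s t : Finset ι} (hst : Disjoint s t) :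
    ∃ U : Set X, IsClopen U ∧ (∀ x ∈ s, e x ∈ U) ∧ ∀ x ∈ t, e x ∉ U := by
  have hopen : IsOpen (e '' t)ᶜ := (t.finite_toSet.image e).isClosed.isOpen_compl
  have hloc : ∀ x ∈ s, ∃ V : Set X, IsClopen V ∧ e x ∈ V ∧ V ⊆ (e '' t)ᶜ := by
    intro x hx
    refine hbasis.exists_subset_of_mem_open ?_ hopen
    rintro ⟨y, hy, hyx⟩
    exact Finset.disjoint_left.mp hst hx (he hyx ▸ hy)
  choose! V hV hmem hsub using hloc
  refine ⟨⋃ x ∈ s, V x, isClopen_biUnion_finset hV,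
    fun x hx => Set.mem_biUnion hx (hmem x hx), fun y hy hU => ?_⟩
  obtain ⟨x, hx, hyV⟩ := Set.mem_iUnion₂.mp hU
  exact hsub x hx hyV ⟨y, hy, rfl⟩

/-- Corollary `corollarynikodymalgebras`. Let `X` be a compact Hausdorff
zero-dimensional space (so `X` is the Stone space of its Boolean algebra of clopen sets) and
let `G` be a free filter on `ω` without the Nikodym property. If `N_G` embeds homeomorphically
into `X`, then the clopen algebra of `X` does not have the Nikodym property: there is a
sequence of finitely additive signed measures of bounded variation on the clopen sets which is
pointwise bounded but not uniformly bounded. -/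
theorem clopen_algebra_not_nikodym {X : Type} [TopologicalSpace X] [CompactSpace X] [T2Space X]
    (hbasis : TopologicalSpace.IsTopologicalBasis {U : Set X | IsClopen U})
    (G : Filter ℕ) (hGfree : G ≤ Filter.cofinite) (hGne : G.NeBot)
    (hG : ¬ HasNikodymProp G)
    (e : Option ℕ → X) (he : @Topology.IsEmbedding _ _ (NFTop G) _ e) :
    ∃ lam : ℕ → (Set X → ℝ),
      (∀ n, ∀ a b : Set X, IsClopen a → IsClopen b → Disjoint a b →
        lam n (a ∪ b) = lam n a + lam n b) ∧
      (∀ n, ∃ C : ℝ, ∀ a b : Set X, IsClopen a → IsClopen b → Disjoint a b →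
        |lam n a| + |lam n b| ≤ C) ∧
      (∀ a : Set X, IsClopen a → ∃ C : ℝ, ∀ n, |lam n a| ≤ C) ∧
      (∀ C : ℝ, ∃ n, ∃ a b : Set X, IsClopen a ∧ IsClopen b ∧ Disjoint a b ∧
        C < |lam n a| + |lam n b|) := by
  obtain ⟨μ, hnorm, hclopen⟩ := not_not.mp hG
  have hcont := @Topology.IsEmbedding.continuous _ _ e (NFTop G) _ he
  refine ⟨fun n a => fsMeas (μ n) (e ⁻¹' a), fun n a b _ _ hab => ?_, fun n => ?_,
    fun a ha => ?_, fun C => ?_⟩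
  · exact fsMeas_union (μ n) (hab.preimage e)
  · exact ⟨fsNorm (μ n) + fsNorm (μ n), fun a b _ _ _ =>
      add_le_add (abs_fsMeas_le _ _) (abs_fsMeas_le _ _)⟩
  · obtain ⟨C, hC⟩ :=
      (hclopen _ (@IsClopen.preimage _ _ (NFTop G) _ _ ha _ hcont)).abs.bddAbove_range
    exact ⟨C, fun n => hC ⟨n, rfl⟩⟩
  · obtain ⟨n, hn⟩ := (hnorm.eventually_gt_atTop C).exists
    have hdisj : Disjoint {x ∈ (μ n).support | 0 < μ n x} {x ∈ (μ n).support | μ n x < 0} :=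
      Finset.disjoint_filter.mpr fun x _ h => h.not_gt
    obtain ⟨U, hU, hpos, hneg⟩ :=
      exists_isClopen_separating_finsets hbasis
        (@Topology.IsEmbedding.injective _ _ (NFTop G) _ e he) hdisj
    refine ⟨n, U, Uᶜ, hU, hU.compl, disjoint_compl_right, hn.trans_le ?_⟩
    refine fsNorm_le_of_separates (μ n) (A := e ⁻¹' U) (fun x hx => hpos x ?_)
      (fun x hx => hneg x ?_)
    · simp [hx, hx.ne']
    · simp [hx, hx.ne]
end
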